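/- arXiv:0808.1155 — 13 statements merged into one kernel-verified Lean document; each statement's English description precedes it below -/
import Mathlib

section
/- Loop series expansion (main theorem): For every finite simple graph G = (V,E) with a consistent positive pseudo-marginal assignment, the 'partition function' Σ_{σ : V → {−1,+1}} Π_{{i,j} ∈ E} b_{ij}(σ_i, σ_j) · Π_{i ∈ V} b_i(σ_i)^{1 − d_i} equals the loop series Σ_{C ⊆ E} ( Π_{{i,j} ∈ C} β_{ij} ) · ( Π_{i ∈ V} f_{d_i(C)}(γ_i) ), where the empty edge subset contributes the term 1. (Consequently only 'generalized loops' — edge subsets C in which no incident vertex has degree one, since f_1 = 0 — contribute nonzero terms.) -/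
/-- The polynomials `f n` defined by `f 0 = 1`, `f 1 = 0`, `f (n+1) = x * f n + f (n-1)`. -/
noncomputable def f : ℕ → ℝ → ℝ
  | 0, _ => 1
  | 1, _ => 0
  | n + 2, x => x * f (n + 1) x + f n x

/-- The product over the edges of a vertex weight at both endpoints collects to vertex powers
given by the degrees. -/
theorem prod_endpoints_eq_prod_pow_degree {V R : Type*} [Fintype V] [DecidableEq V] [CommMonoid R]
    (C : Finset (V × V)) (hC : ∀ p ∈ C, p.1 ≠ p.2) (g : V → R) :
    ∏ p ∈ C, g p.1 * g p.2 = ∏ i : V, g i ^ (C.filter (fun p => p.1 = i ∨ p.2 = i)).card := by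
  have h (p : V × V) (hp : p ∈ C) :
      g p.1 * g p.2 = ∏ i : V, if p.1 = i ∨ p.2 = i then g i else 1 := by
    rw [← Finset.prod_filter, ← Finset.prod_pair (hC p hp)]
    congr 1
    ext i
    simp [eq_comm]
  rw [Finset.prod_congr rfl h, Finset.prod_comm]
  refine Finset.prod_congr rfl fun i _ => ?_
  rw [← Finset.prod_filter, Finset.prod_const]

/-- The polynomials `f n` are the moments of the standardized two-point distribution with
weights `a` and `b`, evaluated at its skewness. -/
theorem two_point_moment_eq_f {a b : ℝ} (ha : 0 < a) (hb : 0 < b) (hab : a + b = 1) (n : ℕ) :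
    b * (√(a * b) / b) ^ n + a * (-√(a * b) / a) ^ n = f n ((a - b) / √(a * b)) := by
  have hs : 0 < √(a * b) := Real.sqrt_pos.mpr (mul_pos ha hb)
  have hsq : √(a * b) ^ 2 = a * b := Real.sq_sqrt (mul_pos ha hb).le
  generalize √(a * b) = s at hs hsq
  have hu : (s / b) ^ 2 = (a - b) / s * (s / b) + 1 := by
    field_simp
    linear_combination hsq
  have hv : (-s / a) ^ 2 = (a - b) / s * (-s / a) + 1 := by
    field_simp
    linear_combination hsq
  induction n using Nat.twoStepInduction with
  | zero => simpa [f, add_comm] using hab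
  | one =>
    simp only [f, pow_one]
    field_simp
    ring
  | more n ih₀ ih₁ =>
    rw [f, ← ih₀, ← ih₁]
    linear_combination b * (s / b) ^ n * hu + a * (-s / a) ^ n * hv

/-- A two-by-two table with total mass `1` differs from the product of its marginals by its
determinant, with the sign `x * y`. -/
theorem table_sub_marginal_mul_marginal {c : ℝ → ℝ → ℝ} {a b : ℝ → ℝ}
    (hsum : a 1 + a (-1) = 1)
    (hrow : ∀ x ∈ ({-1, 1} : Finset ℝ), c x 1 + c x (-1) = a x)
    (hcol : ∀ y ∈ ({-1, 1} : Finset ℝ), c 1 y + c (-1) y = b y)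
    {x y : ℝ} (hx : x ∈ ({-1, 1} : Finset ℝ)) (hy : y ∈ ({-1, 1} : Finset ℝ)) :
    c x y - a x * b y = x * y * (c 1 1 * c (-1) (-1) - c 1 (-1) * c (-1) 1) := by
  have h₁ := hrow 1 (by simp)
  have h₂ := hrow (-1) (by simp)
  rw [← h₁, ← h₂] at hsum
  rw [← hrow x hx, ← hcol y hy]
  simp only [Finset.mem_insert, Finset.mem_singleton] at hx hy
  rcases hx with rfl | rfl <;> rcases hy with rfl | rfl
  · linear_combination -c (-1) (-1) * hsum
  · linear_combination -c (-1) 1 * hsum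
  · linear_combination -c 1 (-1) * hsum
  · linear_combination -c 1 1 * hsum

/-- Loop series expansion (main theorem): for a finite simple graph (edges given by the
finset `E` of ordered pairs, each edge appearing with exactly one orientation) with a
consistent positive pseudo-marginal assignment `(b1, b2)`, the partition function
`Σ_σ Π_{(i,j)∈E} b2 i j (σ i) (σ j) · Π_i b1 i (σ i)^(1-dᵢ)` equals the loop series
`Σ_{C⊆E} (Π_{(i,j)∈C} β i j)(Π_i f_{dᵢ(C)}(γ i))`. -/
theorem loop_series_expansion {V : Type*} [Fintype V] [DecidableEq V]
    (E : Finset (V × V))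
    (hirr : ∀ p ∈ E, p.1 ≠ p.2)
    (hasym : ∀ p ∈ E, (p.2, p.1) ∉ E)
    (b1 : V → ℝ → ℝ) (b2 : V → V → ℝ → ℝ → ℝ)
    (hb1pos : ∀ i : V, 0 < b1 i 1 ∧ 0 < b1 i (-1))
    (hb1sum : ∀ i : V, b1 i 1 + b1 i (-1) = 1)
    (hb2pos : ∀ p ∈ E, ∀ x ∈ ({-1, 1} : Finset ℝ), ∀ y ∈ ({-1, 1} : Finset ℝ),
      0 < b2 p.1 p.2 x y)
    (hb2sym : ∀ i j : V, ∀ x y : ℝ, b2 i j x y = b2 j i y x)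
    (hcons₁ : ∀ p ∈ E, ∀ x ∈ ({-1, 1} : Finset ℝ),
      b2 p.1 p.2 x 1 + b2 p.1 p.2 x (-1) = b1 p.1 x)
    (hcons₂ : ∀ p ∈ E, ∀ y ∈ ({-1, 1} : Finset ℝ),
      b2 p.1 p.2 1 y + b2 p.1 p.2 (-1) y = b1 p.2 y)
    (γ : V → ℝ)
    (hγ : ∀ i : V, γ i = (b1 i 1 - b1 i (-1)) / Real.sqrt (b1 i 1 * b1 i (-1)))
    (β : V → V → ℝ)
    (hβ : ∀ i j : V, β i j =
      (b2 i j 1 1 * b2 i j (-1) (-1) - b2 i j 1 (-1) * b2 i j (-1) 1) /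
        Real.sqrt (b1 i 1 * b1 i (-1) * (b1 j 1 * b1 j (-1)))) :
    ∑ σ : V → ({-1, 1} : Finset ℝ),
        (∏ p ∈ E, b2 p.1 p.2 (σ p.1 : ℝ) (σ p.2 : ℝ)) *
          ∏ i : V, (b1 i (σ i : ℝ)) ^
            ((1 : ℤ) - ((E.filter (fun p => p.1 = i ∨ p.2 = i)).card : ℤ)) =
      ∑ C ∈ E.powerset,
        (∏ p ∈ C, β p.1 p.2) *
          ∏ i : V, f ((C.filter (fun p => p.1 = i ∨ p.2 = i)).card) (γ i) := by
  have hpos (i : V) (x : ℝ) (hx : x ∈ ({-1, 1} : Finset ℝ)) : 0 < b1 i x := by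
    simp only [Finset.mem_insert, Finset.mem_singleton] at hx
    rcases hx with rfl | rfl
    exacts [(hb1pos i).2, (hb1pos i).1]
  let s (i : V) : ℝ := √(b1 i 1 * b1 i (-1))
  have hs (i : V) : 0 < s i := Real.sqrt_pos.mpr (mul_pos (hb1pos i).1 (hb1pos i).2)
  let t (i : V) (x : ℝ) : ℝ := -x * s i / b1 i x
  have hedge (p : V × V) (hp : p ∈ E) (x y : ℝ) (hx : x ∈ ({-1, 1} : Finset ℝ))
      (hy : y ∈ ({-1, 1} : Finset ℝ)) :
      b2 p.1 p.2 x y =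
        b1 p.1 x * b1 p.2 y * (1 + β p.1 p.2 * (t p.1 x * t p.2 y)) := by
    have hD := table_sub_marginal_mul_marginal (hb1sum p.1) (hcons₁ p hp) (hcons₂ p hp) hx hy
    rw [sub_eq_iff_eq_add.mp hD, hβ,
      Real.sqrt_mul (mul_pos (hb1pos p.1).1 (hb1pos p.1).2).le]
    have h₁ := (hs p.1).ne'
    have h₂ := (hs p.2).ne'
    have h₃ := (hpos p.1 x hx).ne'
    have h₄ := (hpos p.2 y hy).ne'
    change _ = b1 p.1 x * b1 p.2 y * (1 + _ / (s p.1 * s p.2) *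
      (-x * s p.1 / b1 p.1 x * (-y * s p.2 / b1 p.2 y)))
    field_simp
    ring
  have hmoment (i : V) (n : ℕ) :
      ∑ x : ({-1, 1} : Finset ℝ), b1 i x * t i x ^ n = f n (γ i) := by
    rw [Finset.sum_coe_sort ({-1, 1} : Finset ℝ) (fun x => b1 i x * t i x ^ n),
      Finset.sum_pair (by norm_num), hγ,
      ← two_point_moment_eq_f (hb1pos i).1 (hb1pos i).2 (hb1sum i)]
    simp [t, s]
  have hterm (σ : V → ({-1, 1} : Finset ℝ)) :
      (∏ p ∈ E, b2 p.1 p.2 (σ p.1 : ℝ) (σ p.2 : ℝ)) *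
          ∏ i : V, (b1 i (σ i : ℝ)) ^
            ((1 : ℤ) - ((E.filter (fun p => p.1 = i ∨ p.2 = i)).card : ℤ)) =
        ∑ C ∈ E.powerset, (∏ p ∈ C, β p.1 p.2) *
          ∏ i : V, b1 i (σ i) *
            t i (σ i) ^ (C.filter (fun p => p.1 = i ∨ p.2 = i)).card := by
    rw [Finset.prod_congr rfl fun p hp => hedge p hp _ _ (σ p.1).2 (σ p.2).2,
      Finset.prod_mul_distrib,
      prod_endpoints_eq_prod_pow_degree E hirr fun i => b1 i (σ i), mul_right_comm,
      ← Finset.prod_mul_distrib, Finset.prod_one_add, Finset.mul_sum]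
    refine Finset.sum_congr rfl fun C hC => ?_
    rw [Finset.prod_mul_distrib (s := C),
      prod_endpoints_eq_prod_pow_degree C
        (fun p hp => hirr p (Finset.mem_powerset.mp hC hp)) fun i => t i (σ i),
      mul_left_comm, ← Finset.prod_mul_distrib]
    congr 1
    refine Finset.prod_congr rfl fun i _ => ?_
    rw [← zpow_natCast (b1 i (σ i)), ← zpow_add₀ (hpos i _ (σ i).2).ne',
      add_sub_cancel, zpow_one]
  rw [Finset.sum_congr rfl fun σ _ => hterm σ, Finset.sum_comm]
  refine Finset.sum_congr rfl fun C _ => ?_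
  simp only [← hmoment, Finset.prod_univ_sum, Fintype.piFinset_univ, Finset.mul_sum]
end

section
/- Propagation identity at a general node (Theorem 4.5, explicit reparametrized form): Let p, q > 0 with p + q = 1, let d ≥ 1 and 0 ≤ n ≤ d be natural numbers. Define μ(+1) = p^{1/d}, μ(−1) = q^{1/d}, ν(+1) = −q^{(d−1)/d} / (pq)^{(d−2)/(2d)}, ν(−1) = p^{(d−1)/d} / (pq)^{(d−2)/(2d)} (real powers of positive reals), and γ = (p − q)/√(pq). Then ν(+1)^n · μ(+1)^{d−n} + ν(−1)^n · μ(−1)^{d−n} = f_n(γ). -/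
/-- If `r` and `s` are roots of `t ^ 2 = x * t + 1`, then a combination `p * r ^ n + q * s ^ n`
with the initial values of `f` is equal to `f n x`. -/
theorem mul_pow_add_mul_pow_eq_f {p q r s x : ℝ} (h0 : p + q = 1) (h1 : p * r + q * s = 0)
    (hr : r ^ 2 = x * r + 1) (hs : s ^ 2 = x * s + 1) :
    ∀ n : ℕ, p * r ^ n + q * s ^ n = f n x
  | 0 => by simpa [f] using h0
  | 1 => by simpa [f] using h1
  | n + 2 => by
    rw [f, ← mul_pow_add_mul_pow_eq_f h0 h1 hr hs (n + 1), ← mul_pow_add_mul_pow_eq_f h0 h1 hr hs n]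
    linear_combination p * r ^ n * hr + q * s ^ n * hs

theorem rpow_div_mul_rpow_eq {x y d : ℝ} (hx : 0 < x) (hy : 0 < y) (hd : d ≠ 0) :
    y ^ ((d - 1) / d) / (x * y) ^ ((d - 2) / (2 * d)) = √y / √x * x ^ (1 / d) := by
  rw [Real.sqrt_eq_rpow, Real.sqrt_eq_rpow, Real.mul_rpow hx.le hy.le]
  simp only [Real.rpow_def_of_pos hx, Real.rpow_def_of_pos hy, ← Real.exp_add, ← Real.exp_sub]
  congr 1
  field_simp
  ring

/-- The `d`-th root of `x`, raised to the power `d - n` and completed by `(r * x ^ (1 / d)) ^ n`. -/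
theorem mul_rpow_pow_mul_pow_sub {x : ℝ} (hx : 0 ≤ x) (r : ℝ) {d n : ℕ} (hd : d ≠ 0)
    (hn : n ≤ d) :
    (r * x ^ ((1 : ℝ) / d)) ^ n * (x ^ ((1 : ℝ) / d)) ^ (d - n) = x * r ^ n := by
  rw [mul_pow, mul_assoc, ← pow_add, Nat.add_sub_cancel' hn, one_div,
    Real.rpow_inv_natCast_pow hx hd, mul_comm]

/-- Propagation identity at a general node (Theorem 4.5, explicit reparametrized form):
with `μ(±1)` and `ν(±1)` the first and secondary messages at a node of degree `d` with
belief `(p, q)`, for `0 ≤ n ≤ d` one has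
`ν(+1)^n μ(+1)^(d-n) + ν(-1)^n μ(-1)^(d-n) = f n γ` where `γ = (p - q)/√(pq)`. -/
theorem propagation_identity (p q : ℝ) (hp : 0 < p) (hq : 0 < q) (hpq : p + q = 1)
    (d n : ℕ) (hd : 1 ≤ d) (hn : n ≤ d)
    (μp μm νp νm γ : ℝ)
    (hμp : μp = p ^ ((1 : ℝ) / d))
    (hμm : μm = q ^ ((1 : ℝ) / d))
    (hνp : νp = -(q ^ (((d : ℝ) - 1) / d)) / (p * q) ^ (((d : ℝ) - 2) / (2 * d)))
    (hνm : νm = p ^ (((d : ℝ) - 1) / d) / (p * q) ^ (((d : ℝ) - 2) / (2 * d)))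
    (hγ : γ = (p - q) / Real.sqrt (p * q)) :
    νp ^ n * μp ^ (d - n) + νm ^ n * μm ^ (d - n) = f n γ := by
  have hd0 : d ≠ 0 := by omega
  have hdR : (d : ℝ) ≠ 0 := Nat.cast_ne_zero.mpr hd0
  have hνp' : νp = -(√q / √p) * p ^ ((1 : ℝ) / d) := by
    rw [hνp, neg_div, rpow_div_mul_rpow_eq hp hq hdR, neg_mul]
  have hνm' : νm = √p / √q * q ^ ((1 : ℝ) / d) := by
    rw [hνm, mul_comm p q, rpow_div_mul_rpow_eq hq hp hdR]
  rw [hνp', hνm', hμp, hμm, mul_rpow_pow_mul_pow_sub hp.le _ hd0 hn,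
    mul_rpow_pow_mul_pow_sub hq.le _ hd0 hn, hγ, Real.sqrt_mul hp.le]
  have hsp : √p ≠ 0 := (Real.sqrt_pos.mpr hp).ne'
  have hsq : √q ≠ 0 := (Real.sqrt_pos.mpr hq).ne'
  have hp2 : √p ^ 2 = p := Real.sq_sqrt hp.le
  have hq2 : √q ^ 2 = q := Real.sq_sqrt hq.le
  apply mul_pow_add_mul_pow_eq_f hpq
  · field_simp
    rw [hp2, hq2]
    ring
  · field_simp
    rw [hp2, hq2]
    ring
  · field_simp
    rw [hp2, hq2]
    ring
end

section
/- Relation between the Chertkov–Chernyak node factor ρ and the polynomials f_n: For every m ∈ (−1, 1) and every natural number n ≥ 1, (( (1 − m)^{n−1} + (−1)^n (1 + m)^{n−1} ) / ( 2 (1 − m²)^{n−1} )) · (1 − m²)^{n/2} = f_n( −2m / √(1 − m²) ) = (−1)^n f_n( 2m / √(1 − m²) ). (Here (1 − m²)^{n/2} denotes the real power of the positive number 1 − m².) -/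
theorem f_neg (n : ℕ) (x : ℝ) : f n (-x) = (-1) ^ n * f n x := by
  induction n using Nat.twoStepInduction with
  | zero => simp [f]
  | one => simp [f]
  | more n ih₀ ih₁ =>
    simp only [f, ih₀, ih₁]
    ring

/-- Binet-type formula: if `s ^ 2 = a * b`, the roots of `t ^ 2 = ((a - b) / s) * t + 1` are
`a / s` and `-b / s`. -/
theorem mul_sub_pow_eq_f {a b s : ℝ} (hs : s ≠ 0) (hab : s ^ 2 = a * b) (k : ℕ) :
    s * (a ^ k - (-b) ^ k) = (a + b) * s ^ k * f (k + 1) ((a - b) / s) := by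
  induction k using Nat.twoStepInduction with
  | zero => simp [f]
  | one => simp [f]; ring
  | more k ih₀ ih₁ =>
    calc s * (a ^ (k + 2) - (-b) ^ (k + 2))
        = (a - b) * (s * (a ^ (k + 1) - (-b) ^ (k + 1))) +
            a * b * (s * (a ^ k - (-b) ^ k)) := by ring
      _ = (a + b) * s ^ (k + 2) * f (k + 2 + 1) ((a - b) / s) := by
        rw [ih₀, ih₁, ← hab, show f (k + 2 + 1) ((a - b) / s) =
          (a - b) / s * f (k + 1 + 1) ((a - b) / s) + f (k + 1) ((a - b) / s) from rfl]
        field_simp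
        ring

/-- Relation between the Chertkov–Chernyak node factor `ρ` and the polynomials `f n`:
for `m ∈ (-1,1)` and `n ≥ 1`,
`ρ_n(m) · (1 - m²)^(n/2) = f n (-2m/√(1-m²)) = (-1)^n f n (2m/√(1-m²))`. -/
theorem rho_eq_f (m : ℝ) (hm : m ∈ Set.Ioo (-1 : ℝ) 1) (n : ℕ) (hn : 1 ≤ n) :
    (((1 - m) ^ (n - 1) + (-1 : ℝ) ^ n * (1 + m) ^ (n - 1)) /
        (2 * (1 - m ^ 2) ^ (n - 1))) * (1 - m ^ 2) ^ ((n : ℝ) / 2) =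
      f n (-2 * m / Real.sqrt (1 - m ^ 2)) ∧
    f n (-2 * m / Real.sqrt (1 - m ^ 2)) = (-1 : ℝ) ^ n * f n (2 * m / Real.sqrt (1 - m ^ 2)) := by
  have hpos : 0 < 1 - m ^ 2 := by nlinarith [hm.1, hm.2]
  refine ⟨?_, by rw [neg_mul, neg_div, f_neg]⟩
  obtain ⟨k, rfl⟩ := Nat.exists_eq_add_of_le' hn
  have hs : Real.sqrt (1 - m ^ 2) ≠ 0 := (Real.sqrt_pos.2 hpos).ne'
  have hsq : Real.sqrt (1 - m ^ 2) ^ 2 = 1 - m ^ 2 := Real.sq_sqrt hpos.le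
  have hpow : (1 - m ^ 2) ^ (((k + 1 : ℕ) : ℝ) / 2) = Real.sqrt (1 - m ^ 2) ^ (k + 1) := by
    rw [Real.rpow_div_two_eq_sqrt _ hpos.le, Real.rpow_natCast]
  have hf := mul_sub_pow_eq_f (a := 1 - m) (b := 1 + m) hs (by rw [hsq]; ring) k
  rw [show 1 - m - (1 + m) = -2 * m by ring, show 1 - m + (1 + m) = 2 by ring, neg_pow] at hf
  rw [hpow, Nat.add_sub_cancel, div_mul_eq_mul_div, div_eq_iff (by positivity)]
  nth_rewrite 3 [← hsq]
  linear_combination Real.sqrt (1 - m ^ 2) ^ k * hf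
end

section
/- Binomial closed form (equation for θ(1,γ)): For every real γ and every natural number L ≥ 1, Σ_{k=0}^{L} (L choose k) · f_{2k}(γ) = ( 2√(4 + γ²) / (γ + √(4 + γ²)) )^{L−1} + ( 2√(4 + γ²) / (√(4 + γ²) − γ) )^{L−1}. -/
/-- Binet formula for `f`, in terms of the roots `a`, `b` of `t ^ 2 = (a + b) * t + 1`. -/
theorem sub_mul_f_add {a b : ℝ} (hab : a * b = -1) (n : ℕ) :
    (a - b) * f n (a + b) = a * b ^ n - b * a ^ n := by
  induction n using Nat.twoStepInduction with
  | zero => simp [f]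
  | one => simp [f, mul_comm]
  | more n ih₀ ih₁ =>
    simp only [f]
    linear_combination (a + b) * ih₁ + ih₀ + (a * b ^ n - b * a ^ n) * hab

theorem sum_choose_mul_f_two_mul {a b : ℝ} (hab : a * b = -1) (hne : a ≠ b) (m : ℕ) :
    ∑ k ∈ Finset.range (m + 2), ((m + 1).choose k : ℝ) * f (2 * k) (a + b) =
      (b * (b - a)) ^ m + (a * (a - b)) ^ m := by
  have binomial (t : ℝ) :
      ∑ k ∈ Finset.range (m + 2), ((m + 1).choose k : ℝ) * t ^ (2 * k) = (t ^ 2 + 1) ^ (m + 1) := by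
    rw [add_pow]
    refine Finset.sum_congr rfl fun k _ => ?_
    rw [pow_mul, one_pow]
    ring
  apply mul_left_cancel₀ (sub_ne_zero.mpr hne)
  calc
    _ = a * (b ^ 2 + 1) ^ (m + 1) - b * (a ^ 2 + 1) ^ (m + 1) := by
      rw [← binomial, ← binomial, Finset.mul_sum, Finset.mul_sum, Finset.mul_sum,
        ← Finset.sum_sub_distrib]
      refine Finset.sum_congr rfl fun k _ => ?_
      linear_combination ((m + 1).choose k : ℝ) * sub_mul_f_add hab (2 * k)
    _ = _ := by
      rw [show b ^ 2 + 1 = b * (b - a) by linear_combination hab,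
        show a ^ 2 + 1 = a * (a - b) by linear_combination hab, pow_succ, pow_succ]
      linear_combination (b - a) * ((b * (b - a)) ^ m + (a * (a - b)) ^ m) * hab

/-- Binomial closed form for `θ(1,γ)`:
`Σ_{k=0}^L (L choose k) f_{2k}(γ)
  = (2√(4+γ²)/(γ+√(4+γ²)))^(L-1) + (2√(4+γ²)/(√(4+γ²)-γ))^(L-1)`. -/
theorem theta_one_gamma (γ : ℝ) (L : ℕ) (hL : 1 ≤ L) :
    ∑ k ∈ Finset.range (L + 1), (L.choose k : ℝ) * f (2 * k) γ =
      (2 * Real.sqrt (4 + γ ^ 2) / (γ + Real.sqrt (4 + γ ^ 2))) ^ (L - 1) +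
      (2 * Real.sqrt (4 + γ ^ 2) / (Real.sqrt (4 + γ ^ 2) - γ)) ^ (L - 1) := by
  obtain ⟨m, rfl⟩ := Nat.exists_eq_add_of_le' hL
  set s := √(4 + γ ^ 2)
  have hsq : s ^ 2 = 4 + γ ^ 2 := Real.sq_sqrt (by positivity)
  have hspos : 0 < s := Real.sqrt_pos.mpr (by positivity)
  have habs : |γ| < s := Real.lt_sqrt_of_sq_lt (by rw [sq_abs]; linarith)
  obtain ⟨hneg, hlt⟩ := abs_lt.mp habs
  have hadd : γ + s ≠ 0 := (neg_lt_iff_pos_add.mp hneg).ne'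
  have hsub : s - γ ≠ 0 := (sub_pos.mpr hlt).ne'
  have hsum := sum_choose_mul_f_two_mul (a := (γ + s) / 2) (b := (γ - s) / 2)
    (by linear_combination -hsq / 4) (fun h => hspos.ne' (by linarith)) m
  rw [show (γ + s) / 2 + (γ - s) / 2 = γ by ring] at hsum
  rw [hsum, Nat.add_sub_cancel]
  congr 2
  · rw [eq_div_iff hadd]
    linear_combination s / 2 * hsq
  · rw [eq_div_iff hsub]
    linear_combination s / 2 * hsq
end

section
/- Topological invariance of the loop polynomial at β = 1: Let G = (V,E) be a finite connected simple graph and let L = |E| − |V| + 1 be its cycle rank. Then for every real γ, Σ_{C ⊆ E} Π_{i ∈ V} f_{d_i(C)}(γ) = Σ_{k=0}^{L} (L choose k) · f_{2k}(γ); in particular this sum depends on the graph G only through L. -/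
/-- If `p` and `q` are the roots of `t ^ 2 = x * t + 1`, then `f n x` is the `n`-th moment of the
probability weights `(1 + p ^ 2)⁻¹`, `(1 + q ^ 2)⁻¹` on `p`, `q`. -/
theorem f_eq_moment {x p q : ℝ} (hsum : p + q = x) (hmul : p * q = -1) (n : ℕ) :
    f n x = (1 + p ^ 2)⁻¹ * p ^ n + (1 + q ^ 2)⁻¹ * q ^ n := by
  have hp : 1 + p ^ 2 ≠ 0 := by positivity
  have hq : 1 + q ^ 2 ≠ 0 := by positivity
  induction n using Nat.twoStepInduction with
  | zero =>
    simp only [f]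
    field_simp
    linear_combination (p * q - 1) * hmul
  | one =>
    simp only [f]
    field_simp
    linear_combination (-(p + q)) * hmul
  | more n ih₀ ih₁ =>
    have hp2 : p ^ 2 = x * p + 1 := by rw [← hsum]; linear_combination -hmul
    have hq2 : q ^ 2 = x * q + 1 := by rw [← hsum]; linear_combination -hmul
    simp only [f]
    rw [ih₀, ih₁]
    linear_combination (-(1 + p ^ 2)⁻¹ * p ^ n) * hp2 + (-(1 + q ^ 2)⁻¹ * q ^ n) * hq2

/-- Binomial sums of the even-indexed `f` are powers of `1 + p ^ 2` and `1 + q ^ 2`. -/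
theorem sum_choose_mul_f_two_mul_s7 {x p q : ℝ} (hsum : p + q = x) (hmul : p * q = -1) (L : ℕ) :
    ∑ k ∈ Finset.range (L + 1), (L.choose k : ℝ) * f (2 * k) x =
      (1 + p ^ 2)⁻¹ * (1 + p ^ 2) ^ L + (1 + q ^ 2)⁻¹ * (1 + q ^ 2) ^ L := by
  rw [add_comm 1 (p ^ 2), add_comm 1 (q ^ 2), add_pow, add_pow, Finset.mul_sum, Finset.mul_sum,
    ← Finset.sum_add_distrib]
  refine Finset.sum_congr rfl fun k _ => ?_
  rw [f_eq_moment hsum hmul, pow_mul, pow_mul]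
  ring

theorem SimpleGraph.Adj.prod_filter_mem {V R : Type*} [Fintype V] [DecidableEq V]
    {G : SimpleGraph V} [CommMonoid R] {u v : V} (h : G.Adj u v)
    (ξ : V → R) : ∏ i with i ∈ s(u, v), ξ i = ξ u * ξ v := by
  have : Finset.univ.filter (fun i => i ∈ s(u, v)) = {u, v} := by ext; simp
  rw [this, Finset.prod_pair h.ne]

section Graph

variable {V : Type*} [Fintype V] [DecidableEq V] (G : SimpleGraph V) [DecidableRel G.Adj]

/-- The generating function of the edge subsets, weighted by vertex variables raised to the
degrees, factors over the edges. -/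
theorem sum_powerset_edgeFinset_prod_pow_degree {R : Type*} [CommRing R] (ξ : V → R) :
    ∑ C ∈ G.edgeFinset.powerset, ∏ i : V, ξ i ^ (C.filter (fun e => i ∈ e)).card =
      ∏ e ∈ G.edgeFinset, (1 + ∏ i with i ∈ e, ξ i) := by
  rw [Finset.prod_one_add]
  refine Finset.sum_congr rfl fun C _ => ?_
  simp_rw [← Finset.prod_const]
  exact Finset.prod_comm' (by simp [and_comm])

variable {G}

theorem SimpleGraph.prod_edgeFinset_one_add_prod_const {R : Type*} [CommRing R] (r : R) :
    ∏ e ∈ G.edgeFinset, (1 + ∏ i with i ∈ e, r) = (1 + r ^ 2) ^ G.edgeFinset.card := by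
  refine Finset.prod_eq_pow_card fun e he => ?_
  induction e with
  | _ u v =>
    rw [SimpleGraph.mem_edgeFinset, SimpleGraph.mem_edgeSet] at he
    rw [he.prod_filter_mem fun _ => r, sq]

/-- A vertex labelling of a connected graph with values in the two numbers `r true`, `r false` of
product `-1` has vanishing edge product unless it is constant. -/
theorem SimpleGraph.Connected.prod_edgeFinset_eq_zero {R : Type*} [CommRing R]
    (hconn : G.Connected) (r : Bool → R) (hr : r true * r false = -1) (s : V → Bool)
    (hs : ∀ b, s ≠ fun _ => b) :
    ∏ e ∈ G.edgeFinset, (1 + ∏ i with i ∈ e, r (s i)) = 0 := by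
  obtain ⟨u, v, huv, hne⟩ : ∃ u v, G.Adj u v ∧ s u ≠ s v := by
    by_contra! h
    obtain ⟨v₀⟩ := hconn.nonempty
    refine hs (s v₀) (funext fun v => ?_)
    obtain ⟨w⟩ := hconn.preconnected v v₀
    induction w with
    | nil => rfl
    | cons hadj _ ih => exact (h _ _ hadj).trans ih
  refine Finset.prod_eq_zero (i := s(u, v)) (by simpa using huv) ?_
  rw [huv.prod_filter_mem fun i => r (s i)]
  cases hu : s u <;> cases hv : s v <;> simp_all [mul_comm (r false)]

end Graph

/-- Topological invariance of the loop polynomial at `β = 1`: for a finite connected simple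
graph with cycle rank `L`, `Σ_{C ⊆ E} Π_i f_{d_i(C)}(γ) = Σ_{k=0}^L (L choose k) f_{2k}(γ)`;
in particular the sum depends on the graph only through `L`. -/
theorem loop_polynomial_beta_one {V : Type*} [Fintype V] [DecidableEq V]
    (G : SimpleGraph V) [DecidableRel G.Adj] (hconn : G.Connected)
    (L : ℕ) (hL : (L : ℤ) = (G.edgeFinset.card : ℤ) - (Fintype.card V : ℤ) + 1)
    (γ : ℝ) :
    ∑ C ∈ G.edgeFinset.powerset, ∏ i : V, f ((C.filter (fun e => i ∈ e)).card) γ =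
      ∑ k ∈ Finset.range (L + 1), (L.choose k : ℝ) * f (2 * k) γ := by
  obtain ⟨p, q, hsum, hmul⟩ : ∃ p q : ℝ, p + q = γ ∧ p * q = -1 := by
    refine ⟨(γ + √(γ ^ 2 + 4)) / 2, (γ - √(γ ^ 2 + 4)) / 2, by ring, ?_⟩
    linear_combination (-1 / 4) * Real.sq_sqrt (show 0 ≤ γ ^ 2 + 4 by positivity)
  rw [sum_choose_mul_f_two_mul_s7 hsum hmul]
  let r : Bool → ℝ := fun b => if b then p else q
  let w : Bool → ℝ := fun b => (1 + r b ^ 2)⁻¹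
  have hf (n : ℕ) : f n γ = ∑ b, w b * r b ^ n := by
    simp [w, r, f_eq_moment hsum hmul]
  simp_rw [hf, Finset.prod_univ_sum, Fintype.piFinset_univ, Finset.prod_mul_distrib]
  rw [Finset.sum_comm]
  simp_rw [← Finset.mul_sum]
  have hfactor (s : V → Bool) := sum_powerset_edgeFinset_prod_pow_degree G fun i => r (s i)
  simp_rw [hfactor]
  have hcard : G.edgeFinset.card + 1 = L + Fintype.card V := by omega
  have hpow (a : ℝ) (ha : a ≠ 0) :
      a⁻¹ ^ Fintype.card V * a ^ G.edgeFinset.card = a⁻¹ * a ^ L := by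
    have := congrArg (a ^ ·) hcard
    simp only [pow_succ, pow_add] at this
    rw [inv_pow]
    field_simp
    linear_combination this
  obtain ⟨v₀⟩ := hconn.nonempty
  have hne : (fun _ : V => true) ≠ fun _ => false := fun h => by simpa using congrFun h v₀
  rw [Finset.sum_eq_add_of_mem _ _ (Finset.mem_univ _) (Finset.mem_univ _) hne]
  · simp only [SimpleGraph.prod_edgeFinset_one_add_prod_const]
    simp only [Finset.prod_const, Finset.card_univ, w, r, if_true, Bool.false_eq_true, if_false]
    rw [hpow _ (by positivity), hpow _ (by positivity)]
  · rintro s - ⟨ht, hf⟩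
    rw [hconn.prod_edgeFinset_eq_zero r (by simpa [r] using hmul) s (by simp [ht, hf]), mul_zero]
end

section
/- Upper bound on the number of generalized loops: Let G = (V,E) be a finite connected simple graph with cycle rank L = |E| − |V| + 1 ≥ 1. Let 𝒢₀ be the set of edge subsets C ⊆ E (including the empty set) such that every vertex incident to at least one edge of C is incident to at least two edges of C (i.e., C is a generalized loop or empty). Then |𝒢₀| ≤ ((5 − √5)/2)^{L−1} + ((5 + √5)/2)^{L−1}, with equality if and only if every C ∈ 𝒢₀ satisfies d_i(C) ≤ 3 for all vertices i. -/
/-- The vertex weight: the Fibonacci sequence shifted so that it starts `1, 0, 1, 1, 2, …`. -/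
def loopWeight : ℕ → ℕ
  | 0 => 1
  | 1 => 0
  | n + 2 => loopWeight n + loopWeight (n + 1)

theorem loopWeight_pos {n : ℕ} (hn : n ≠ 1) : 1 ≤ loopWeight n := by
  induction n using Nat.strong_induction_on with
  | _ n ih =>
    match n with
    | 0 => simp [loopWeight]
    | 1 => exact absurd rfl hn
    | 2 => simp [loopWeight]
    | n + 3 =>
      have := ih (n + 2) (by omega) (by omega)
      have h : loopWeight (n + 3) = loopWeight (n + 1) + loopWeight (n + 2) := rfl
      omega

theorem one_lt_loopWeight {n : ℕ} (hn : 4 ≤ n) : 1 < loopWeight n := by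
  obtain ⟨k, rfl⟩ := Nat.exists_eq_add_of_le' hn
  have h1 : 1 ≤ loopWeight (k + 2) := loopWeight_pos (by omega)
  have h2 : 1 ≤ loopWeight (k + 3) := loopWeight_pos (by omega)
  have : loopWeight (k + 4) = loopWeight (k + 2) + loopWeight (k + 3) := rfl
  omega

theorem loopWeight_eq_one_iff {n : ℕ} (hn : n ≠ 1) : loopWeight n = 1 ↔ n ≤ 3 := by
  constructor
  · intro h
    by_contra! h'
    have := one_lt_loopWeight h'
    omega
  · intro h
    interval_cases n <;> simp_all [loopWeight]

/-- The two roots of `x ^ 2 = x + 1`, indexed by `Bool`. -/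
noncomputable def goldenRoot (b : Bool) : ℝ := if b then (1 + √5) / 2 else (1 - √5) / 2

/-- The squares of the roots of `x ^ 2 = x + 1`, plus one. -/
noncomputable def goldenBase (b : Bool) : ℝ := if b then (5 + √5) / 2 else (5 - √5) / 2

theorem goldenRoot_sq (b : Bool) : goldenRoot b ^ 2 = 1 + goldenRoot b := by
  have h : √5 ^ 2 = (5 : ℝ) := Real.sq_sqrt (by norm_num)
  cases b <;> simp only [goldenRoot, if_true, Bool.false_eq_true, if_false] <;> nlinarith

theorem one_add_goldenRoot_sq (b : Bool) : 1 + goldenRoot b ^ 2 = goldenBase b := by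
  rw [goldenRoot_sq]
  cases b <;> simp [goldenRoot, goldenBase] <;> ring

theorem goldenRoot_mul_of_ne {b c : Bool} (h : b ≠ c) : goldenRoot b * goldenRoot c = -1 := by
  have h5 : √5 ^ 2 = (5 : ℝ) := Real.sq_sqrt (by norm_num)
  cases b <;> cases c <;>
    simp only [ne_eq, not_true_eq_false, goldenRoot, if_true, Bool.false_eq_true, if_false] at h ⊢ <;>
    nlinarith

theorem goldenBase_pos (b : Bool) : 0 < goldenBase b := by
  rw [← one_add_goldenRoot_sq]
  positivity

theorem loopWeight_eq_sum (n : ℕ) :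
    (loopWeight n : ℝ) = ∑ b : Bool, (goldenBase b)⁻¹ * goldenRoot b ^ n := by
  have h5 : √5 ^ 2 = (5 : ℝ) := Real.sq_sqrt (by norm_num)
  have ht : 5 + √5 ≠ 0 := by simpa [goldenBase] using (goldenBase_pos true).ne'
  have hf : 5 - √5 ≠ 0 := by simpa [goldenBase] using (goldenBase_pos false).ne'
  induction n using Nat.strong_induction_on with
  | _ n ih =>
    match n with
    | 0 =>
      simp only [loopWeight, goldenBase, goldenRoot, Fintype.sum_bool]
      simp
      field_simp
      nlinarith
    | 1 =>
      simp only [loopWeight, goldenBase, goldenRoot, Fintype.sum_bool]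
      simp
      field_simp
      nlinarith
    | n + 2 =>
      rw [loopWeight, Nat.cast_add, ih n (by omega), ih (n + 1) (by omega),
        ← Finset.sum_add_distrib]
      refine Finset.sum_congr rfl fun b _ => ?_
      rw [pow_add _ n 2, goldenRoot_sq]
      ring

theorem SimpleGraph.Connected.exists_eq_const {V α : Type*} {G : SimpleGraph V}
    (hconn : G.Connected) (σ : V → α)
    (h : ∀ u v, G.Adj u v → σ u = σ v) : ∃ b, σ = fun _ => b := by
  obtain ⟨r⟩ := hconn.nonempty
  refine ⟨σ r, funext fun v => ?_⟩
  obtain ⟨p⟩ := hconn.preconnected v r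
  induction p with
  | nil => rfl
  | cons hadj _ ih => exact (h _ _ hadj).trans ih

section

variable {V : Type*} [Fintype V] [DecidableEq V]

theorem prod_pow_card_incident {R : Type*} [CommMonoid R] (x : V → R) (C : Finset (Sym2 V)) :
    ∏ i, x i ^ (C.filter (fun e => i ∈ e)).card =
      ∏ e ∈ C, ∏ i ∈ Finset.univ.filter (fun i => i ∈ e), x i := by
  simp_rw [← Finset.prod_const, Finset.prod_filter]
  exact Finset.prod_comm

theorem prod_mem_sym2_mk {R : Type*} [CommMonoid R] (x : V → R) {u v : V} (h : u ≠ v) :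
    ∏ i ∈ Finset.univ.filter (fun i => i ∈ s(u, v)), x i = x u * x v := by
  rw [← Finset.prod_pair h]
  congr 1
  ext i
  simp

variable (G : SimpleGraph V) [DecidableRel G.Adj]

theorem prod_edge_one_add_const (b : Bool) :
    ∏ e ∈ G.edgeFinset, (1 + ∏ _i ∈ Finset.univ.filter (fun i => i ∈ e), goldenRoot b) =
      goldenBase b ^ G.edgeFinset.card := by
  refine Finset.prod_eq_pow_card fun e he => ?_
  induction e using Sym2.ind with
  | _ u v =>
    have huv : G.Adj u v := by simpa using he
    rw [prod_mem_sym2_mk (fun _ => goldenRoot b) huv.ne, ← one_add_goldenRoot_sq, sq]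

variable {G}

theorem prod_edge_one_add_eq_zero (hconn : G.Connected) (σ : V → Bool)
    (h : ∀ b, σ ≠ fun _ => b) :
    ∏ e ∈ G.edgeFinset,
      (1 + ∏ i ∈ Finset.univ.filter (fun i => i ∈ e), goldenRoot (σ i)) = 0 := by
  have : ∃ u v, G.Adj u v ∧ σ u ≠ σ v := by
    by_contra! h'
    obtain ⟨b, hb⟩ := hconn.exists_eq_const σ h'
    exact h b hb
  obtain ⟨u, v, huv, hne⟩ := this
  refine Finset.prod_eq_zero (i := s(u, v)) (by simpa using huv) ?_
  rw [prod_mem_sym2_mk (fun i => goldenRoot (σ i)) huv.ne, goldenRoot_mul_of_ne hne]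
  norm_num

theorem sum_prod_loopWeight (hconn : G.Connected) {k : ℕ}
    (hk : G.edgeFinset.card = Fintype.card V + k) :
    ((∑ C ∈ G.edgeFinset.powerset,
        ∏ i, loopWeight (C.filter (fun e => i ∈ e)).card : ℕ) : ℝ) =
      ((5 - √5) / 2) ^ k + ((5 + √5) / 2) ^ k := by
  have hspin : ((∑ C ∈ G.edgeFinset.powerset,
        ∏ i, loopWeight (C.filter (fun e => i ∈ e)).card : ℕ) : ℝ) =
      ∑ σ : V → Bool, (∏ i, (goldenBase (σ i))⁻¹) *
        ∏ e ∈ G.edgeFinset,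
          (1 + ∏ i ∈ Finset.univ.filter (fun i => i ∈ e), goldenRoot (σ i)) := by
    push_cast
    simp_rw [loopWeight_eq_sum, Finset.prod_univ_sum, Fintype.piFinset_univ,
      Finset.prod_one_add, Finset.mul_sum, Finset.prod_mul_distrib]
    rw [Finset.sum_comm]
    refine Finset.sum_congr rfl fun σ _ => Finset.sum_congr rfl fun C _ => ?_
    rw [prod_pow_card_incident (fun i => goldenRoot (σ i))]
  have hconst (b : Bool) : (∏ _i : V, (goldenBase b)⁻¹) *
      ∏ e ∈ G.edgeFinset, (1 + ∏ _i ∈ Finset.univ.filter (fun i => i ∈ e), goldenRoot b) =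
        goldenBase b ^ k := by
    have := (goldenBase_pos b).ne'
    rw [prod_edge_one_add_const, hk, Finset.prod_const, Finset.card_univ, pow_add, inv_pow]
    field_simp
  obtain ⟨r⟩ := hconn.nonempty
  have hinj : Function.Injective (fun (b : Bool) (_ : V) => b) := fun b c h => congrFun h r
  rw [hspin, ← Fintype.sum_of_injective (fun (b : Bool) (_ : V) => b) hinj
    (fun b => goldenBase b ^ k) _ ?_ fun b => (hconst b).symm]
  · simp [goldenBase, add_comm]
  · intro σ hσ
    rw [prod_edge_one_add_eq_zero hconn σ fun b hb => hσ ⟨b, hb.symm⟩, mul_zero]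

end


/-- Upper bound on the number of generalized loops: for a connected simple graph with cycle
rank `L ≥ 1`, the number of edge subsets `C` (including `∅`) in which every incident vertex
has degree at least two is at most `((5-√5)/2)^(L-1) + ((5+√5)/2)^(L-1)`, with equality iff
every such `C` satisfies `d_i(C) ≤ 3` for all vertices `i`. -/
theorem generalized_loops_bound {V : Type*} [Fintype V] [DecidableEq V]
    (G : SimpleGraph V) [DecidableRel G.Adj] (hconn : G.Connected)
    (L : ℕ) (hL : (L : ℤ) = (G.edgeFinset.card : ℤ) - (Fintype.card V : ℤ) + 1)
    (hL1 : 1 ≤ L) :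
    (((G.edgeFinset.powerset.filter (fun C => ∀ i : V,
          1 ≤ (C.filter (fun e => i ∈ e)).card → 2 ≤ (C.filter (fun e => i ∈ e)).card)).card : ℝ) ≤
        ((5 - Real.sqrt 5) / 2) ^ (L - 1) + ((5 + Real.sqrt 5) / 2) ^ (L - 1)) ∧
    ((((G.edgeFinset.powerset.filter (fun C => ∀ i : V,
          1 ≤ (C.filter (fun e => i ∈ e)).card → 2 ≤ (C.filter (fun e => i ∈ e)).card)).card : ℝ) =
        ((5 - Real.sqrt 5) / 2) ^ (L - 1) + ((5 + Real.sqrt 5) / 2) ^ (L - 1)) ↔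
      ∀ C ∈ G.edgeFinset.powerset.filter (fun C => ∀ i : V,
          1 ≤ (C.filter (fun e => i ∈ e)).card → 2 ≤ (C.filter (fun e => i ∈ e)).card),
        ∀ i : V, (C.filter (fun e => i ∈ e)).card ≤ 3) := by
  have hk : G.edgeFinset.card = Fintype.card V + (L - 1) := by omega
  rw [← sum_prod_loopWeight hconn hk, Nat.cast_le, Nat.cast_inj]
  set S := G.edgeFinset.powerset.filter (fun C => ∀ i : V,
    1 ≤ (C.filter (fun e => i ∈ e)).card → 2 ≤ (C.filter (fun e => i ∈ e)).card) with hS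
  have hne {C} (hC : C ∈ S) (i : V) : (C.filter (fun e => i ∈ e)).card ≠ 1 := by
    have := (Finset.mem_filter.1 hC).2 i
    omega
  have hsum : ∑ C ∈ G.edgeFinset.powerset, ∏ i, loopWeight (C.filter (fun e => i ∈ e)).card =
      ∑ C ∈ S, ∏ i, loopWeight (C.filter (fun e => i ∈ e)).card := by
    symm
    refine Finset.sum_subset (Finset.filter_subset _ _) fun C hC hCS => ?_
    simp only [hS, Finset.mem_filter, hC, true_and, not_forall] at hCS
    obtain ⟨i, h1, h2⟩ := hCS
    refine Finset.prod_eq_zero (Finset.mem_univ i) ?_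
    rw [show (C.filter (fun e => i ∈ e)).card = 1 by omega, loopWeight]
  have hle : ∀ C ∈ S, 1 ≤ ∏ i, loopWeight (C.filter (fun e => i ∈ e)).card := fun C hC =>
    Nat.one_le_iff_ne_zero.2 <| Finset.prod_ne_zero_iff.2 fun i _ =>
      Nat.one_le_iff_ne_zero.1 (loopWeight_pos (hne hC i))
  rw [hsum, Finset.card_eq_sum_ones]
  refine ⟨Finset.sum_le_sum hle, ?_⟩
  rw [Finset.sum_eq_sum_iff_of_le hle]
  refine forall₂_congr fun C hC => ?_
  constructor
  · intro h i
    rw [← loopWeight_eq_one_iff (hne hC i)]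
    exact Nat.dvd_one.1 (h ▸ Finset.dvd_prod_of_mem _ (Finset.mem_univ i))
  · intro h
    exact (Finset.prod_eq_one fun i _ => (loopWeight_eq_one_iff (hne hC i)).2 (h i)).symm
end

section
/- Propagation of secondary messages through a chain of degree-two nodes (Lemma 4.1): Let ψ be a 2×2 real matrix with positive entries. Let μ_{ji}, μ_{kl} ∈ ℝ² have positive entries, and set μ_{jk} := ψ μ_{kl} and μ_{kj} := ψᵀ μ_{ji}. Suppose ν_{ji}, ν_{jk}, ν_{kj}, ν_{kl} ∈ ℝ² are nonzero vectors satisfying ⟨ν_{ji}, μ_{jk}⟩ = 0, ⟨μ_{ji}, ν_{jk}⟩ = 0, ⟨ν_{ji}, ν_{jk}⟩ = 1, ⟨ν_{kj}, μ_{kl}⟩ = 0, ⟨μ_{kj}, ν_{kl}⟩ = 0, and ⟨ν_{kj}, ν_{kl}⟩ = 1. Then there exists a single real number β such that ψ ν_{kl} = β ν_{jk} and ψᵀ ν_{ji} = β ν_{kj}. -/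
open Matrix

/-- In the plane, a vector `w` orthogonal to the same nonzero vector `m` as `v` is a multiple
of `v`, with coefficient `u ⬝ᵥ w` for any `u` with `u ⬝ᵥ v = 1`. -/
theorem eq_dotProduct_smul_of_orthogonal {m u v w : Fin 2 → ℝ} (hm : m 0 ≠ 0)
    (hv : m ⬝ᵥ v = 0) (hw : m ⬝ᵥ w = 0) (huv : u ⬝ᵥ v = 1) : w = (u ⬝ᵥ w) • v := by
  simp only [dotProduct, Fin.sum_univ_two] at hv hw huv ⊢
  have hdet : v 0 * w 1 - v 1 * w 0 = 0 := by
    apply mul_left_cancel₀ hm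
    linear_combination w 1 * hv - v 1 * hw
  ext i
  fin_cases i
  · simp only [Fin.zero_eta, Pi.smul_apply, smul_eq_mul]
    linear_combination -w 0 * huv - u 1 * hdet
  · simp only [Fin.mk_one, Pi.smul_apply, smul_eq_mul]
    linear_combination -w 1 * huv + u 0 * hdet

/-- Propagation of secondary messages through a chain of degree-two nodes (Lemma 4.1):
under the stated orthogonality and normalization conditions, the secondary messages
propagate with a single rate `β` in both directions. -/
theorem secondary_message_propagation_deg2
    (ψ : Matrix (Fin 2) (Fin 2) ℝ) (hψ : ∀ a b, 0 < ψ a b)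
    (μji μkl : Fin 2 → ℝ) (hμji : ∀ a, 0 < μji a) (hμkl : ∀ a, 0 < μkl a)
    (μjk μkj : Fin 2 → ℝ)
    (hμjk : μjk = ψ.mulVec μkl) (hμkj : μkj = ψ.transpose.mulVec μji)
    (νji νjk νkj νkl : Fin 2 → ℝ)
    (hνji : νji ≠ 0) (hνjk : νjk ≠ 0) (hνkj : νkj ≠ 0) (hνkl : νkl ≠ 0)
    (o1 : νji ⬝ᵥ μjk = 0) (o2 : μji ⬝ᵥ νjk = 0) (n1 : νji ⬝ᵥ νjk = 1)
    (o3 : νkj ⬝ᵥ μkl = 0) (o4 : μkj ⬝ᵥ νkl = 0) (n2 : νkj ⬝ᵥ νkl = 1) :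
    ∃ β : ℝ, ψ.mulVec νkl = β • νjk ∧ ψ.transpose.mulVec νji = β • νkj := by
  subst hμjk hμkj
  refine ⟨νji ⬝ᵥ ψ.mulVec νkl,
    eq_dotProduct_smul_of_orthogonal (hμji 0).ne' o2 ?_ n1, ?_⟩
  · rwa [mulVec_transpose, ← dotProduct_mulVec] at o4
  · rw [dotProduct_mulVec, ← mulVec_transpose, dotProduct_comm]
    refine eq_dotProduct_smul_of_orthogonal (hμkl 0).ne' ?_ ?_ ?_
    · rwa [dotProduct_comm]
    · rwa [dotProduct_comm, mulVec_transpose, ← dotProduct_mulVec]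
    · rwa [dotProduct_comm]
end

section
/- Propagation of secondary messages at a degree-three node (Lemma 4.2): Let ψ be a 2×2 real matrix with positive entries, indexed as ψ(x_j, x_i) for x_j, x_i ∈ {−1,+1}. Let μ₂, μ₃ : {−1,+1} → (0,∞) and μ_{ii'} : {−1,+1} → (0,∞), and define μ₁(x_j) := Σ_{x_i} ψ(x_j,x_i) μ_{ii'}(x_i) and μ_{ij}(x_i) := Σ_{x_j} ψ(x_j,x_i) μ₂(x_j) μ₃(x_j). Suppose ν₁, ν₂, ν₃, ν_{ii'}, ν_{ij} : {−1,+1} → ℝ are nonzero and satisfy: Σ_x ν₁(x)μ₂(x)μ₃(x) = 0, Σ_x μ₁(x)ν₂(x)μ₃(x) = 0, Σ_x μ₁(x)μ₂(x)ν₃(x) = 0, Σ_x ν₁(x)ν₂(x)μ₃(x) = 1, Σ_x μ₁(x)ν₂(x)ν₃(x) = 1, Σ_x ν₁(x)μ₂(x)ν₃(x) = 1, together with Σ_x ν_{ij}(x)μ_{ii'}(x) = 0, Σ_x μ_{ij}(x)ν_{ii'}(x) = 0, and Σ_x ν_{ij}(x)ν_{ii'}(x) = 1. Then there exists a single real number β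 such that for all x_j, x_i ∈ {−1,+1}: Σ_{x_i} ψ(x_j,x_i) ν_{ii'}(x_i) = β ν₁(x_j), Σ_{x_j} ψ(x_j,x_i) ν₃(x_j) μ₂(x_j) = β ν_{ij}(x_i), and Σ_{x_j} ψ(x_j,x_i) μ₃(x_j) ν₂(x_j) = β ν_{ij}(x_i). -/
/-- On a two-point set, a function annihilated by a positive weight `p` is determined by its
pairing with any `w` that is dual to a function `u` annihilated by `p`. -/
theorem eq_pairing_mul_of_orthogonal (p u v w : ℝ → ℝ)
    (hp : ∀ x ∈ ({-1, 1} : Finset ℝ), 0 < p x)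
    (hu : ∑ x ∈ ({-1, 1} : Finset ℝ), u x * p x = 0)
    (hv : ∑ x ∈ ({-1, 1} : Finset ℝ), v x * p x = 0)
    (huw : ∑ x ∈ ({-1, 1} : Finset ℝ), u x * w x = 1) :
    ∀ x ∈ ({-1, 1} : Finset ℝ), v x = (∑ y ∈ ({-1, 1} : Finset ℝ), v y * w y) * u x := by
  have hne : (-1 : ℝ) ≠ 1 := by norm_num
  have hp1 : p 1 ≠ 0 := (hp 1 (by simp)).ne'
  simp only [Finset.sum_pair hne] at *
  have hdet : u (-1) * v 1 = u 1 * v (-1) := by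
    apply mul_right_cancel₀ hp1
    linear_combination u (-1) * hv - v (-1) * hu
  simp only [Finset.mem_insert, Finset.mem_singleton, forall_eq_or_imp, forall_eq]
  constructor
  · linear_combination -v (-1) * huw - w 1 * hdet
  · linear_combination -v 1 * huw + w (-1) * hdet


/-- Propagation of secondary messages at a degree-three node (Lemma 4.2): under the stated
orthogonality and normalization conditions there is a single rate `β` governing the
propagation of the secondary messages through the edge `(j,i)`. -/
theorem secondary_message_propagation_deg3
    (ψ : ℝ → ℝ → ℝ)
    (hψ : ∀ xj ∈ ({-1, 1} : Finset ℝ), ∀ xi ∈ ({-1, 1} : Finset ℝ), 0 < ψ xj xi)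
    (μ₂ μ₃ μii' : ℝ → ℝ)
    (hμ₂ : ∀ x ∈ ({-1, 1} : Finset ℝ), 0 < μ₂ x)
    (hμ₃ : ∀ x ∈ ({-1, 1} : Finset ℝ), 0 < μ₃ x)
    (hμii' : ∀ x ∈ ({-1, 1} : Finset ℝ), 0 < μii' x)
    (μ₁ μij : ℝ → ℝ)
    (hμ₁ : ∀ xj, μ₁ xj = ∑ xi ∈ ({-1, 1} : Finset ℝ), ψ xj xi * μii' xi)
    (hμij : ∀ xi, μij xi = ∑ xj ∈ ({-1, 1} : Finset ℝ), ψ xj xi * μ₂ xj * μ₃ xj)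
    (ν₁ ν₂ ν₃ νii' νij : ℝ → ℝ)
    (hν₁ne : ∃ x ∈ ({-1, 1} : Finset ℝ), ν₁ x ≠ 0)
    (hν₂ne : ∃ x ∈ ({-1, 1} : Finset ℝ), ν₂ x ≠ 0)
    (hν₃ne : ∃ x ∈ ({-1, 1} : Finset ℝ), ν₃ x ≠ 0)
    (hνii'ne : ∃ x ∈ ({-1, 1} : Finset ℝ), νii' x ≠ 0)
    (hνijne : ∃ x ∈ ({-1, 1} : Finset ℝ), νij x ≠ 0)
    (o1 : ∑ x ∈ ({-1, 1} : Finset ℝ), ν₁ x * μ₂ x * μ₃ x = 0)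
    (o2 : ∑ x ∈ ({-1, 1} : Finset ℝ), μ₁ x * ν₂ x * μ₃ x = 0)
    (o3 : ∑ x ∈ ({-1, 1} : Finset ℝ), μ₁ x * μ₂ x * ν₃ x = 0)
    (n1 : ∑ x ∈ ({-1, 1} : Finset ℝ), ν₁ x * ν₂ x * μ₃ x = 1)
    (n2 : ∑ x ∈ ({-1, 1} : Finset ℝ), μ₁ x * ν₂ x * ν₃ x = 1)
    (n3 : ∑ x ∈ ({-1, 1} : Finset ℝ), ν₁ x * μ₂ x * ν₃ x = 1)
    (o4 : ∑ x ∈ ({-1, 1} : Finset ℝ), νij x * μii' x = 0)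
    (o5 : ∑ x ∈ ({-1, 1} : Finset ℝ), μij x * νii' x = 0)
    (n4 : ∑ x ∈ ({-1, 1} : Finset ℝ), νij x * νii' x = 1) :
    ∃ β : ℝ,
      (∀ xj ∈ ({-1, 1} : Finset ℝ),
        ∑ xi ∈ ({-1, 1} : Finset ℝ), ψ xj xi * νii' xi = β * ν₁ xj) ∧
      (∀ xi ∈ ({-1, 1} : Finset ℝ),
        ∑ xj ∈ ({-1, 1} : Finset ℝ), ψ xj xi * ν₃ xj * μ₂ xj = β * νij xi) ∧
      (∀ xi ∈ ({-1, 1} : Finset ℝ),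
        ∑ xj ∈ ({-1, 1} : Finset ℝ), ψ xj xi * μ₃ xj * ν₂ xj = β * νij xi) := by
  have hne : (-1 : ℝ) ≠ 1 := by norm_num
  have h1 := eq_pairing_mul_of_orthogonal (fun x => μ₂ x * μ₃ x) ν₁
    (fun xj => ∑ xi ∈ ({-1, 1} : Finset ℝ), ψ xj xi * νii' xi) (fun x => ν₂ x * μ₃ x)
    (fun x hx => mul_pos (hμ₂ x hx) (hμ₃ x hx))
    (by simpa only [mul_assoc] using o1)
    (by
      simp only [Finset.sum_pair hne, hμij] at o5 ⊢
      linear_combination o5)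
    (by simpa only [mul_assoc] using n1)
  have h2 := eq_pairing_mul_of_orthogonal μii' νij
    (fun xi => ∑ xj ∈ ({-1, 1} : Finset ℝ), ψ xj xi * ν₃ xj * μ₂ xj) νii' hμii' o4
    (by
      simp only [Finset.sum_pair hne, hμ₁] at o3 ⊢
      linear_combination o3) n4
  have h3 := eq_pairing_mul_of_orthogonal μii' νij
    (fun xi => ∑ xj ∈ ({-1, 1} : Finset ℝ), ψ xj xi * μ₃ xj * ν₂ xj) νii' hμii' o4
    (by
      simp only [Finset.sum_pair hne, hμ₁] at o2 ⊢
      linear_combination o2) n4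
  set β := ∑ y ∈ ({-1, 1} : Finset ℝ),
    (∑ xi ∈ ({-1, 1} : Finset ℝ), ψ y xi * νii' xi) * (ν₂ y * μ₃ y) with hβ
  have hβ₃ : ∑ y ∈ ({-1, 1} : Finset ℝ),
      (∑ xj ∈ ({-1, 1} : Finset ℝ), ψ xj y * ν₃ xj * μ₂ xj) * νii' y = β := by
    have hm := h1 (-1) (by simp)
    have hp := h1 1 (by simp)
    clear_value β
    simp only [Finset.sum_pair hne] at hm hp n3 ⊢
    linear_combination ν₃ (-1) * μ₂ (-1) * hm + ν₃ 1 * μ₂ 1 * hp + β * n3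
  have hβ₂ : ∑ y ∈ ({-1, 1} : Finset ℝ),
      (∑ xj ∈ ({-1, 1} : Finset ℝ), ψ xj y * μ₃ xj * ν₂ xj) * νii' y = β := by
    rw [hβ]
    simp only [Finset.sum_pair hne]
    ring
  rw [hβ₃] at h2
  rw [hβ₂] at h3
  exact ⟨β, h1, h2, h3⟩
end

section
/- Three colliding secondary messages produce γ (Lemma 4.3): Let μ₁, μ₂, μ₃ : {−1,+1} → (0,∞) satisfy Σ_{x} μ₁(x)μ₂(x)μ₃(x) = 1, and set b(x) := μ₁(x)μ₂(x)μ₃(x). Suppose ν₁, ν₂, ν₃ : {−1,+1} → ℝ satisfy ν_a(+1) < 0 for a = 1,2,3 and the six conditions: Σ_x ν₁μ₂μ₃ = 0, Σ_x μ₁ν₂μ₃ = 0, Σ_x μ₁μ₂ν₃ = 0, Σ_x ν₁ν₂μ₃ = 1, Σ_x μ₁ν₂ν₃ = 1, Σ_x ν₁μ₂ν₃ = 1. Then Σ_{x ∈ {−1,+1}} ν₁(x) ν₂(x) ν₃(x) = ( b(+1) − b(−1) ) / √( b(+1) b(−1) ). -/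
/-- On a two-point probability space with weights `p`, `q`, three centred variables with pairwise
correlations `1` and negative first values have third mixed moment `(p - q) / √(p * q)`. -/
theorem third_moment_two_point {p q r₁ r₂ r₃ s₁ s₂ s₃ : ℝ} (hp : 0 < p) (hq : 0 < q)
    (hpq : q + p = 1) (hr₁ : r₁ < 0) (hr₂ : r₂ < 0) (hr₃ : r₃ < 0)
    (c₁ : q * s₁ + p * r₁ = 0) (c₂ : q * s₂ + p * r₂ = 0) (c₃ : q * s₃ + p * r₃ = 0)
    (h₁₂ : q * (s₁ * s₂) + p * (r₁ * r₂) = 1) (h₂₃ : q * (s₂ * s₃) + p * (r₂ * r₃) = 1)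
    (h₁₃ : q * (s₁ * s₃) + p * (r₁ * r₃) = 1) :
    q * (s₁ * s₂ * s₃) + p * (r₁ * r₂ * r₃) = (p - q) / √(p * q) := by
  have pair {r s r' s' : ℝ} (c : q * s + p * r = 0) (c' : q * s' + p * r' = 0)
      (h : q * (s * s') + p * (r * r') = 1) : p * (r * r') = q := by
    linear_combination q * h - q * s' * c + p * r * c' - p * r * r' * hpq
  have e₁₂ := pair c₁ c₂ h₁₂
  have e₂₃ := pair c₂ c₃ h₂₃
  have e₁₃ := pair c₁ c₃ h₁₃
  obtain rfl : r₁ = r₂ :=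
    mul_right_cancel₀ hr₃.ne (mul_left_cancel₀ hp.ne' (e₁₃.trans e₂₃.symm))
  obtain rfl : r₁ = r₃ :=
    mul_left_cancel₀ hr₁.ne (mul_left_cancel₀ hp.ne' (e₁₂.trans e₁₃.symm))
  have hsqrt : √(p * q) = -(p * r₁) := by
    rw [← Real.sqrt_sq (neg_nonneg.2 (mul_neg_of_pos_of_neg hp hr₁).le)]
    congr 1
    linear_combination -p * e₁₂
  have value {s : ℝ} (c : q * s + p * r₁ = 0) : s = -(p * r₁) / q := by
    rw [eq_div_iff hq.ne']
    linear_combination c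
  have hne : -(p * r₁) ≠ 0 := neg_ne_zero.2 (mul_ne_zero hp.ne' hr₁.ne)
  rw [hsqrt, value c₁, value c₂, value c₃, eq_div_iff hne]
  have hq₀ := hq.ne'
  field_simp
  linear_combination (p ^ 2 - q ^ 2) * (p * r₁ ^ 2 + q) * e₁₂ + q ^ 2 * (p - q) * hpq

/-- Three colliding secondary messages produce `γ` (Lemma 4.3): with `b = μ₁μ₂μ₃` the belief
at a degree-three node, `Σ_x ν₁(x)ν₂(x)ν₃(x) = (b(+1) - b(-1))/√(b(+1)b(-1))`. -/
theorem three_secondary_messages_gamma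
    (μ₁ μ₂ μ₃ : ℝ → ℝ)
    (hμ₁ : ∀ x ∈ ({-1, 1} : Finset ℝ), 0 < μ₁ x)
    (hμ₂ : ∀ x ∈ ({-1, 1} : Finset ℝ), 0 < μ₂ x)
    (hμ₃ : ∀ x ∈ ({-1, 1} : Finset ℝ), 0 < μ₃ x)
    (hnorm : ∑ x ∈ ({-1, 1} : Finset ℝ), μ₁ x * μ₂ x * μ₃ x = 1)
    (ν₁ ν₂ ν₃ : ℝ → ℝ)
    (hν₁ : ν₁ 1 < 0) (hν₂ : ν₂ 1 < 0) (hν₃ : ν₃ 1 < 0)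
    (o1 : ∑ x ∈ ({-1, 1} : Finset ℝ), ν₁ x * μ₂ x * μ₃ x = 0)
    (o2 : ∑ x ∈ ({-1, 1} : Finset ℝ), μ₁ x * ν₂ x * μ₃ x = 0)
    (o3 : ∑ x ∈ ({-1, 1} : Finset ℝ), μ₁ x * μ₂ x * ν₃ x = 0)
    (n1 : ∑ x ∈ ({-1, 1} : Finset ℝ), ν₁ x * ν₂ x * μ₃ x = 1)
    (n2 : ∑ x ∈ ({-1, 1} : Finset ℝ), μ₁ x * ν₂ x * ν₃ x = 1)
    (n3 : ∑ x ∈ ({-1, 1} : Finset ℝ), ν₁ x * μ₂ x * ν₃ x = 1) :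
    ∑ x ∈ ({-1, 1} : Finset ℝ), ν₁ x * ν₂ x * ν₃ x =
      (μ₁ 1 * μ₂ 1 * μ₃ 1 - μ₁ (-1) * μ₂ (-1) * μ₃ (-1)) /
        Real.sqrt ((μ₁ 1 * μ₂ 1 * μ₃ 1) * (μ₁ (-1) * μ₂ (-1) * μ₃ (-1))) := by
  have hne : (-1 : ℝ) ∉ ({1} : Finset ℝ) := by norm_num
  simp only [Finset.sum_insert hne, Finset.sum_singleton] at *
  have pos {μ : ℝ → ℝ} (h : ∀ x ∈ ({-1, 1} : Finset ℝ), 0 < μ x) : 0 < μ (-1) ∧ 0 < μ 1 :=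
    ⟨h _ (by simp), h _ (by simp)⟩
  obtain ⟨a₁, b₁⟩ := pos hμ₁
  obtain ⟨a₂, b₂⟩ := pos hμ₂
  obtain ⟨a₃, b₃⟩ := pos hμ₃
  have key := third_moment_two_point (p := μ₁ 1 * μ₂ 1 * μ₃ 1)
    (q := μ₁ (-1) * μ₂ (-1) * μ₃ (-1))
    (r₁ := ν₁ 1 / μ₁ 1) (r₂ := ν₂ 1 / μ₂ 1) (r₃ := ν₃ 1 / μ₃ 1)
    (s₁ := ν₁ (-1) / μ₁ (-1)) (s₂ := ν₂ (-1) / μ₂ (-1)) (s₃ := ν₃ (-1) / μ₃ (-1))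
    (by positivity) (by positivity) hnorm
    (div_neg_of_neg_of_pos hν₁ b₁) (div_neg_of_neg_of_pos hν₂ b₂) (div_neg_of_neg_of_pos hν₃ b₃)
    (.trans (by field_simp) o1) (.trans (by field_simp) o2) (.trans (by field_simp) o3)
    (.trans (by field_simp) n1) (.trans (by field_simp) n2) (.trans (by field_simp) n3)
  rw [← key]
  field_simp
end

section
/- Explicit form of the secondary messages at a degree-three node: Under the hypotheses of Lemma 4.3 (μ₁, μ₂, μ₃ : {−1,+1} → (0,∞) with Σ_x μ₁μ₂μ₃ = 1; ν₁, ν₂, ν₃ with negative first components satisfying the six orthogonality/normalization conditions Σ ν₁μ₂μ₃ = Σ μ₁ν₂μ₃ = Σ μ₁μ₂ν₃ = 0 and Σ ν₁ν₂μ₃ = Σ μ₁ν₂ν₃ = Σ ν₁μ₂ν₃ = 1), the secondary messages are uniquely determined and given explicitly by ν₁(x) = −x · √( μ₁(+1)μ₁(−1) / ( μ₂(+1)μ₂(−1) μ₃(+1)μ₃(−1) ) ) · μ₂(−x) μ₃(−x) for x ∈ {−1,+1}, and analogously for ν₂ and ν₃ by permuting the indices. -/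
/-- A vector in the plane with negative first coordinate which is orthogonal to a positive vector
`(p, q)` is a positive multiple of `(-q, p)`. -/
lemma exists_pos_mul_of_orthogonal {x y p q : ℝ} (hq : 0 < q) (hx : x < 0)
    (h : y * q + x * p = 0) : ∃ s, 0 < s ∧ x = -s * q ∧ y = s * p := by
  refine ⟨-x / q, div_pos (neg_pos.mpr hx) hq, ?_, ?_⟩
  · field_simp
  · field_simp
    linarith

/-- Three positive reals are determined by their pairwise products. -/
lemma eq_sqrt_of_pairwise_mul_eq_one {s t r a b c : ℝ} (hs : 0 < s) (hb : 0 < b) (hc : 0 < c)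
    (hst : s * t * c = 1) (hsr : s * r * b = 1) (htr : t * r * a = 1) :
    s = Real.sqrt (a / (b * c)) := by
  refine (Real.sqrt_eq_iff_mul_self_eq_of_pos hs).mpr ?_ |>.symm
  rw [eq_div_iff (by positivity)]
  linear_combination a * (s * r * b) * hst + a * hsr - s * s * b * c * htr


/-- Explicit form of the secondary messages at a degree-three node: under the hypotheses of
Lemma 4.3 the secondary messages are uniquely determined and given by
`ν₁(x) = -x √(μ₁(+)μ₁(-) / (μ₂(+)μ₂(-)μ₃(+)μ₃(-))) μ₂(-x) μ₃(-x)`, and analogously for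
`ν₂`, `ν₃` by permuting the indices. -/
theorem secondary_messages_explicit
    (μ₁ μ₂ μ₃ : ℝ → ℝ)
    (hμ₁ : ∀ x ∈ ({-1, 1} : Finset ℝ), 0 < μ₁ x)
    (hμ₂ : ∀ x ∈ ({-1, 1} : Finset ℝ), 0 < μ₂ x)
    (hμ₃ : ∀ x ∈ ({-1, 1} : Finset ℝ), 0 < μ₃ x)
    (hnorm : ∑ x ∈ ({-1, 1} : Finset ℝ), μ₁ x * μ₂ x * μ₃ x = 1)
    (ν₁ ν₂ ν₃ : ℝ → ℝ)
    (hν₁ : ν₁ 1 < 0) (hν₂ : ν₂ 1 < 0) (hν₃ : ν₃ 1 < 0)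
    (o1 : ∑ x ∈ ({-1, 1} : Finset ℝ), ν₁ x * μ₂ x * μ₃ x = 0)
    (o2 : ∑ x ∈ ({-1, 1} : Finset ℝ), μ₁ x * ν₂ x * μ₃ x = 0)
    (o3 : ∑ x ∈ ({-1, 1} : Finset ℝ), μ₁ x * μ₂ x * ν₃ x = 0)
    (n1 : ∑ x ∈ ({-1, 1} : Finset ℝ), ν₁ x * ν₂ x * μ₃ x = 1)
    (n2 : ∑ x ∈ ({-1, 1} : Finset ℝ), μ₁ x * ν₂ x * ν₃ x = 1)
    (n3 : ∑ x ∈ ({-1, 1} : Finset ℝ), ν₁ x * μ₂ x * ν₃ x = 1) :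
    (∀ x ∈ ({-1, 1} : Finset ℝ),
      ν₁ x = -x * Real.sqrt (μ₁ 1 * μ₁ (-1) / (μ₂ 1 * μ₂ (-1) * (μ₃ 1 * μ₃ (-1)))) *
        μ₂ (-x) * μ₃ (-x)) ∧
    (∀ x ∈ ({-1, 1} : Finset ℝ),
      ν₂ x = -x * Real.sqrt (μ₂ 1 * μ₂ (-1) / (μ₁ 1 * μ₁ (-1) * (μ₃ 1 * μ₃ (-1)))) *
        μ₁ (-x) * μ₃ (-x)) ∧
    (∀ x ∈ ({-1, 1} : Finset ℝ),
      ν₃ x = -x * Real.sqrt (μ₃ 1 * μ₃ (-1) / (μ₁ 1 * μ₁ (-1) * (μ₂ 1 * μ₂ (-1)))) *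
        μ₁ (-x) * μ₂ (-x)) := by
  have hne : (-1 : ℝ) ≠ 1 := by norm_num
  rw [Finset.sum_pair hne] at hnorm o1 o2 o3 n1 n2 n3
  simp only [Finset.forall_mem_insert, Finset.mem_singleton, forall_eq] at hμ₁ hμ₂ hμ₃ ⊢
  obtain ⟨a_neg, a_pos⟩ := hμ₁
  obtain ⟨b_neg, b_pos⟩ := hμ₂
  obtain ⟨c_neg, c_pos⟩ := hμ₃
  obtain ⟨s, hs, s_pos, s_neg⟩ := exists_pos_mul_of_orthogonal (y := ν₁ (-1))
    (p := μ₂ 1 * μ₃ 1) (mul_pos b_neg c_neg) hν₁ (by linarith)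
  obtain ⟨t, ht, t_pos, t_neg⟩ := exists_pos_mul_of_orthogonal (y := ν₂ (-1))
    (p := μ₁ 1 * μ₃ 1) (mul_pos a_neg c_neg) hν₂ (by linarith)
  obtain ⟨r, hr, r_pos, r_neg⟩ := exists_pos_mul_of_orthogonal (y := ν₃ (-1))
    (p := μ₁ 1 * μ₂ 1) (mul_pos a_neg b_neg) hν₃ (by linarith)
  rw [s_pos, s_neg, t_pos, t_neg] at n1
  rw [t_pos, t_neg, r_pos, r_neg] at n2
  rw [s_pos, s_neg, r_pos, r_neg] at n3
  have hst : s * t * (μ₃ 1 * μ₃ (-1)) = 1 := by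
    linear_combination n1 - s * t * (μ₃ 1 * μ₃ (-1)) * hnorm
  have htr : t * r * (μ₁ 1 * μ₁ (-1)) = 1 := by
    linear_combination n2 - t * r * (μ₁ 1 * μ₁ (-1)) * hnorm
  have hsr : s * r * (μ₂ 1 * μ₂ (-1)) = 1 := by
    linear_combination n3 - s * r * (μ₂ 1 * μ₂ (-1)) * hnorm
  have ha := mul_pos a_pos a_neg
  have hb := mul_pos b_pos b_neg
  have hc := mul_pos c_pos c_neg
  rw [← eq_sqrt_of_pairwise_mul_eq_one hs hb hc hst hsr htr,
    ← eq_sqrt_of_pairwise_mul_eq_one ht ha hc (mul_comm s t ▸ hst) htr hsr,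
    ← eq_sqrt_of_pairwise_mul_eq_one hr ha hb (mul_comm s r ▸ hsr) (mul_comm t r ▸ htr) hst,
    s_pos, s_neg, t_pos, t_neg, r_pos, r_neg, neg_neg]
  refine ⟨⟨?_, ?_⟩, ⟨?_, ?_⟩, ⟨?_, ?_⟩⟩ <;> ring
end

section
/- Ising partition function on a regular graph via the loop polynomial (Corollary 5.2): Let G = (V,E) be a finite simple d-regular graph with d ≥ 1, and let y, z ∈ (−1,1). Set β = (1 − y²)z / (1 − y²z²) and γ = 2y(1+z) / √((1 − y²)(1 − y²z²)). Define b₂(x,x') = (1/4)(1 + xγ/√(4+γ²) + x'γ/√(4+γ²) + xx'γ²/(4+γ²)) + xx'β/(4+γ²) for x, x' ∈ {−1,+1}, and b₁(x) = Σ_{x'} b₂(x,x'). Let K = artanh(z), let h be the real number with e^{2h} = ((1+y)/(1−y)) · ((1+yz)/(1−yz))^{1−d}, and let Z(K,h) = Σ_{σ : V → {−1,+1}} exp( K Σ_{{i,j} ∈ E} σ_i σ_j + h Σ_{i ∈ V} σ_i ). Then Σ_{σ : V → {−1,+1}} Π_{{i,j} ∈ E} b₂(σ_i, σ_j) · Π_{i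 ∈ V} b₁(σ_i)^{1−d} = Z(K,h) · ( √(1−z²)(1 + y²z) / (1 − y²z²) )^{|E|} · ( √((1−y²)(1−y²z²)) / (2(1 + y²z)) )^{|V|}. -/
/-- In a `d`-regular graph, the product over edges of the values of `f` at both endpoints
is the product over vertices of `f i ^ d`. -/
theorem prod_endpoints_eq_prod_pow {V R : Type*} [Fintype V] [DecidableEq V] [CommMonoid R]
    (E : Finset (V × V)) (hirr : ∀ p ∈ E, p.1 ≠ p.2) (d : ℕ)
    (hreg : ∀ i : V, (E.filter (fun p => p.1 = i ∨ p.2 = i)).card = d) (f : V → R) :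
    ∏ p ∈ E, f p.1 * f p.2 = ∏ i : V, f i ^ d := by
  have h1 : ∀ p ∈ E, f p.1 * f p.2 = ∏ i ∈ ({p.1, p.2} : Finset V), f i :=
    fun p hp => (Finset.prod_pair (hirr p hp)).symm
  rw [Finset.prod_congr rfl h1]
  rw [Finset.prod_comm' (t' := Finset.univ)
    (s' := fun i => E.filter (fun p => p.1 = i ∨ p.2 = i))]
  · simp [Finset.prod_const, hreg]
  · intro p i
    simp [eq_comm]

theorem one_add_mul_tanh_eq {x : ℝ} (hx : x = -1 ∨ x = 1) (K : ℝ) :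
    1 + x * Real.tanh K = Real.exp (K * x) * √(1 - Real.tanh K ^ 2) := by
  have hc := Real.cosh_pos K
  have hs : √(1 - Real.tanh K ^ 2) = 1 / Real.cosh K := by
    have hsq : 1 - Real.tanh K ^ 2 = (1 / Real.cosh K) ^ 2 := by
      rw [Real.tanh_eq_sinh_div_cosh]
      field_simp
      linarith [Real.cosh_sq K]
    rw [hsq, Real.sqrt_sq (by positivity)]
  rw [hs, Real.tanh_eq_sinh_div_cosh]
  rcases hx with rfl | rfl
  · rw [mul_neg_one, ← Real.cosh_sub_sinh]
    field_simp
    ring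
  · rw [mul_one, ← Real.cosh_add_sinh]
    field_simp

section BetheMarginals

variable {y z : ℝ}

theorem four_add_sq_loopField (hD : 0 < (1 - y ^ 2) * (1 - y ^ 2 * z ^ 2)) :
    4 + (2 * y * (1 + z) / √((1 - y ^ 2) * (1 - y ^ 2 * z ^ 2))) ^ 2 =
      (2 * (1 + y ^ 2 * z) / √((1 - y ^ 2) * (1 - y ^ 2 * z ^ 2))) ^ 2 := by
  rw [div_pow, div_pow, Real.sq_sqrt hD.le, eq_div_iff hD.ne', add_mul, div_mul_cancel₀ _ hD.ne']
  ring

/-- The pairwise belief factors into one-site weights and the Ising interaction. -/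
theorem pairBelief_eq (hD : 0 < (1 - y ^ 2) * (1 - y ^ 2 * z ^ 2)) (ha : 0 < 1 + y ^ 2 * z)
    {β γ : ℝ} (hβ : β = (1 - y ^ 2) * z / (1 - y ^ 2 * z ^ 2))
    (hγ : γ = 2 * y * (1 + z) / √((1 - y ^ 2) * (1 - y ^ 2 * z ^ 2)))
    {x x' : ℝ} (hx : x ^ 2 = 1) (hx' : x' ^ 2 = 1) :
    (1 / 4) * (1 + x * γ / √(4 + γ ^ 2) + x' * γ / √(4 + γ ^ 2) +
        x * x' * γ ^ 2 / (4 + γ ^ 2)) + x * x' * β / (4 + γ ^ 2) =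
      (1 + x * y) * (1 + x' * y) * (1 + x * x' * z) / (4 * (1 + y ^ 2 * z)) := by
  have hW : 1 - y ^ 2 * z ^ 2 ≠ 0 := right_ne_zero_of_mul hD.ne'
  have hr := Real.sqrt_pos.2 hD
  have h4 := four_add_sq_loopField hD
  rw [← hγ] at h4
  have hs : √(4 + γ ^ 2) = 2 * (1 + y ^ 2 * z) / √((1 - y ^ 2) * (1 - y ^ 2 * z ^ 2)) := by
    rw [h4, Real.sqrt_sq (by positivity)]
  have hm : γ / √(4 + γ ^ 2) = y * (1 + z) / (1 + y ^ 2 * z) := by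
    rw [hs, hγ]
    field_simp
  have hm2 : γ ^ 2 / (4 + γ ^ 2) = (y * (1 + z) / (1 + y ^ 2 * z)) ^ 2 := by
    rw [← hm, div_pow, Real.sq_sqrt (by positivity)]
  have hb : β / (4 + γ ^ 2) = (1 - y ^ 2) ^ 2 * z / (4 * (1 + y ^ 2 * z) ^ 2) := by
    rw [h4, hβ, div_pow, Real.sq_sqrt hD.le]
    field_simp
    ring
  rw [mul_div_assoc, mul_div_assoc, mul_div_assoc, mul_div_assoc, hm, hm2, hb]
  field_simp
  linear_combination (-(x' * y * z + x' ^ 2 * y ^ 2 * z) * (1 + y ^ 2 * z)) * hx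
    - (x * y * z + y ^ 2 * z) * (1 + y ^ 2 * z) * hx'

/-- The external field weight of a spin, with the exponent `1 - d` split off. -/
theorem exp_field_mul_eq (hy : y ∈ Set.Ioo (-1 : ℝ) 1) {w : ℝ} (hw : w ∈ Set.Ioo (-1 : ℝ) 1)
    {h : ℝ} {n : ℤ} (hh : Real.exp (2 * h) = ((1 + y) / (1 - y)) * ((1 + w) / (1 - w)) ^ n)
    {x : ℝ} (hx : x = -1 ∨ x = 1) :
    (1 + x * y) / √(1 - y ^ 2) * ((1 + x * w) / √(1 - w ^ 2)) ^ n = Real.exp (h * x) := by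
  obtain ⟨hy1, hy2⟩ := hy
  obtain ⟨hw1, hw2⟩ := hw
  have p1 : 0 < 1 + y := by linarith
  have p2 : 0 < 1 - y := by linarith
  have p3 : 0 < 1 + w := by linarith
  have p4 : 0 < 1 - w := by linarith
  have hY : 1 - y ^ 2 = (1 + y) * (1 - y) := by ring
  have hW : 1 - w ^ 2 = (1 + w) * (1 - w) := by ring
  have hxy : 0 < 1 + x * y := by rcases hx with rfl | rfl <;> linarith
  have hxw : 0 < 1 + x * w := by rcases hx with rfl | rfl <;> linarith
  have hYp : 0 < √(1 - y ^ 2) := Real.sqrt_pos.2 (by rw [hY]; positivity)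
  have hWp : 0 < √(1 - w ^ 2) := Real.sqrt_pos.2 (by rw [hW]; positivity)
  rw [← sq_eq_sq₀ (by positivity) (by positivity), mul_pow, ← zpow_natCast (_ ^ n), zpow_comm,
    zpow_natCast, div_pow, div_pow, Real.sq_sqrt (by rw [hY]; positivity),
    Real.sq_sqrt (by rw [hW]; positivity), ← Real.exp_nat_mul, hY, hW]
  rcases hx with rfl | rfl
  · have e1 : ((2 : ℕ) : ℝ) * (h * -1) = -(2 * h) := by push_cast; ring
    rw [e1, Real.exp_neg, hh, mul_inv, ← inv_zpow, inv_div, inv_div]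
    have key : ∀ t : ℝ, 0 < 1 - t → (1 + -1 * t) ^ 2 / ((1 + t) * (1 - t)) = (1 - t) / (1 + t) := by
      intro t ht
      rw [neg_one_mul, ← sub_eq_add_neg, sq, mul_div_mul_right _ _ ht.ne']
    rw [key y p2, key w p4]
  · have e1 : ((2 : ℕ) : ℝ) * (h * 1) = 2 * h := by push_cast; ring
    rw [e1, hh]
    have key : ∀ t : ℝ, 0 < 1 + t → (1 + 1 * t) ^ 2 / ((1 + t) * (1 - t)) = (1 + t) / (1 - t) := by
      intro t ht
      rw [one_mul, sq, mul_div_mul_left _ _ ht.ne']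
    rw [key y p1, key w p3]

end BetheMarginals


/-- Ising partition function on a regular graph via the loop polynomial (Corollary 5.2):
for a finite simple `d`-regular graph (edges given by the finset `E` of ordered pairs, each
edge appearing with exactly one orientation) and `y, z ∈ (-1,1)`, the loop-series polynomial
`θ(β,γ) = Σ_σ Π_edges b₂ Π_vertices b₁^(1-d)` equals
`Z(K,h) · (√(1-z²)(1+y²z)/(1-y²z²))^|E| · (√((1-y²)(1-y²z²))/(2(1+y²z)))^|V|`. -/
theorem ising_regular_loop_polynomial {V : Type*} [Fintype V] [DecidableEq V]
    (E : Finset (V × V))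
    (hirr : ∀ p ∈ E, p.1 ≠ p.2)
    (hasym : ∀ p ∈ E, (p.2, p.1) ∉ E)
    (d : ℕ) (hd : 1 ≤ d)
    (hreg : ∀ i : V, (E.filter (fun p => p.1 = i ∨ p.2 = i)).card = d)
    (y z : ℝ) (hy : y ∈ Set.Ioo (-1 : ℝ) 1) (hz : z ∈ Set.Ioo (-1 : ℝ) 1)
    (β γ : ℝ)
    (hβ : β = (1 - y ^ 2) * z / (1 - y ^ 2 * z ^ 2))
    (hγ : γ = 2 * y * (1 + z) / Real.sqrt ((1 - y ^ 2) * (1 - y ^ 2 * z ^ 2)))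
    (b₂ : ℝ → ℝ → ℝ)
    (hb₂ : ∀ x x' : ℝ, b₂ x x' =
      (1 / 4) * (1 + x * γ / Real.sqrt (4 + γ ^ 2) + x' * γ / Real.sqrt (4 + γ ^ 2) +
        x * x' * γ ^ 2 / (4 + γ ^ 2)) + x * x' * β / (4 + γ ^ 2))
    (b₁ : ℝ → ℝ) (hb₁ : ∀ x : ℝ, b₁ x = b₂ x 1 + b₂ x (-1))
    (K h : ℝ)
    (hK : Real.tanh K = z)
    (hh : Real.exp (2 * h) =
      ((1 + y) / (1 - y)) * ((1 + y * z) / (1 - y * z)) ^ ((1 : ℤ) - (d : ℤ)))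
    (Z : ℝ)
    (hZ : Z = ∑ σ : V → ({-1, 1} : Finset ℝ),
      Real.exp (K * ∑ p ∈ E, (σ p.1 : ℝ) * (σ p.2 : ℝ) + h * ∑ i : V, (σ i : ℝ))) :
    ∑ σ : V → ({-1, 1} : Finset ℝ),
        (∏ p ∈ E, b₂ (σ p.1 : ℝ) (σ p.2 : ℝ)) *
          ∏ i : V, (b₁ (σ i : ℝ)) ^ ((1 : ℤ) - (d : ℤ)) =
      Z * (Real.sqrt (1 - z ^ 2) * (1 + y ^ 2 * z) / (1 - y ^ 2 * z ^ 2)) ^ E.card *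
        (Real.sqrt ((1 - y ^ 2) * (1 - y ^ 2 * z ^ 2)) / (2 * (1 + y ^ 2 * z))) ^
          (Fintype.card V) := by
  obtain ⟨hy1, hy2⟩ := hy
  obtain ⟨hz1, hz2⟩ := hz
  have hyy : y ^ 2 < 1 := by nlinarith
  have hzz : z ^ 2 < 1 := by nlinarith
  have hyz : (y * z) ^ 2 < 1 := by
    rw [mul_pow]
    nlinarith [sq_nonneg y]
  have hyzI : y * z ∈ Set.Ioo (-1 : ℝ) 1 := by
    rw [Set.mem_Ioo, ← abs_lt]
    exact (sq_lt_one_iff_abs_lt_one _).1 hyz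
  have hYp : 0 < 1 - y ^ 2 := by linarith
  have hWp : 0 < 1 - y ^ 2 * z ^ 2 := by linarith [mul_pow y z 2]
  have ha : 0 < 1 + y ^ 2 * z := by nlinarith [sq_nonneg y]
  have hD := mul_pos hYp hWp
  have hrW := Real.sqrt_pos.2 hWp
  have hrY := Real.sqrt_pos.2 hYp
  set g : ℝ → ℝ := fun x => (1 + x * y) * √(1 - y ^ 2 * z ^ 2) / (2 * (1 + y ^ 2 * z)) with hg
  set Ce := √(1 - z ^ 2) * (1 + y ^ 2 * z) / (1 - y ^ 2 * z ^ 2) with hCe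
  set Cv := √((1 - y ^ 2) * (1 - y ^ 2 * z ^ 2)) / (2 * (1 + y ^ 2 * z)) with hCv
  have hsq : ∀ {x : ℝ}, x = -1 ∨ x = 1 → x ^ 2 = 1 := by
    rintro x (rfl | rfl) <;> norm_num
  have hpair : ∀ x x' : ℝ, x = -1 ∨ x = 1 → x' = -1 ∨ x' = 1 →
      b₂ x x' = (1 + x * y) * (1 + x' * y) * (1 + x * x' * z) / (4 * (1 + y ^ 2 * z)) := by
    intro x x' hx hx'
    rw [hb₂, pairBelief_eq hD ha hβ hγ (hsq hx) (hsq hx')]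
  have hedge : ∀ x x' : ℝ, x = -1 ∨ x = 1 → x' = -1 ∨ x' = 1 →
      b₂ x x' = Real.exp (K * (x * x')) * Ce * (g x * g x') := by
    intro x x' hx hx'
    have hxx : x * x' = -1 ∨ x * x' = 1 := by
      rcases hx with rfl | rfl <;> rcases hx' with rfl | rfl <;> norm_num
    have ht := one_add_mul_tanh_eq hxx K
    rw [hK] at ht
    have hS := Real.sq_sqrt hWp.le
    rw [hpair x x' hx hx', ht, hCe]
    simp only [hg]
    field_simp
    rw [hS]
    ring
  have hsite : ∀ x : ℝ, x = -1 ∨ x = 1 →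
      g x ^ d * b₁ x ^ ((1 : ℤ) - (d : ℤ)) = Cv * Real.exp (h * x) := by
    intro x hx
    have hxy : 0 < 1 + x * y := by rcases hx with rfl | rfl <;> linarith
    have hgx : g x ≠ 0 := by simp only [hg]; positivity
    have hb : b₁ x = g x * ((1 + x * (y * z)) / √(1 - (y * z) ^ 2)) := by
      rw [hb₁, hpair x 1 hx (Or.inr rfl), hpair x (-1) hx (Or.inl rfl), mul_pow]
      simp only [hg]
      field_simp
      ring
    rw [hb, mul_zpow, ← mul_assoc, ← zpow_natCast (g x), ← zpow_add₀ hgx, add_sub_cancel,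
      zpow_one, ← exp_field_mul_eq ⟨hy1, hy2⟩ hyzI hh hx, ← mul_assoc]
    have hgC : g x = Cv * ((1 + x * y) / √(1 - y ^ 2)) := by
      rw [hCv, Real.sqrt_mul hYp.le]
      simp only [hg]
      field_simp
    rw [hgC, mul_assoc]
  rw [hZ, Finset.sum_mul, Finset.sum_mul]
  refine Finset.sum_congr rfl fun σ _ => ?_
  have hσ : ∀ i, (σ i : ℝ) = -1 ∨ (σ i : ℝ) = 1 := fun i => by
    have := (σ i).2
    rwa [Finset.mem_insert, Finset.mem_singleton] at this
  rw [Finset.prod_congr rfl fun p _ => hedge _ _ (hσ p.1) (hσ p.2), Finset.prod_mul_distrib,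
    prod_endpoints_eq_prod_pow E hirr d hreg (fun i => g (σ i : ℝ)), mul_assoc,
    ← Finset.prod_mul_distrib, Finset.prod_congr rfl fun i _ => hsite _ (hσ i),
    Finset.prod_mul_distrib, Finset.prod_mul_distrib, Finset.prod_const, Finset.prod_const,
    ← Real.exp_sum, ← Real.exp_sum, ← Finset.mul_sum, ← Finset.mul_sum, Real.exp_add,
    Finset.card_univ]
  ring
end

section
/- Sign agreement of true and Bethe marginals on a single cycle (Corollary 6.2, transfer-matrix form): Let T be a 2×2 real matrix with all entries positive, let λ > 0, and let u, v ∈ ℝ² have all components positive with T u = λ u and Tᵀ v = λ v. Then T₁₁ − T₂₂ and u₁v₁ − u₂v₂ have the same sign: T₁₁ − T₂₂ > 0 if and only if u₁v₁ − u₂v₂ > 0, and T₁₁ − T₂₂ = 0 if and only if u₁v₁ − u₂v₂ = 0. -/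
open Matrix

/-- Sign agreement of true and Bethe marginals on a single cycle (Corollary 6.2,
transfer-matrix form): for a positive 2×2 matrix `T` with positive right and left
eigenvectors `u, v` for the eigenvalue `λ > 0`, the quantities `T₁₁ - T₂₂` and
`u₁v₁ - u₂v₂` have the same sign. -/
theorem sign_agreement_one_cycle
    (T : Matrix (Fin 2) (Fin 2) ℝ) (hT : ∀ a b, 0 < T a b)
    (l : ℝ) (hl : 0 < l)
    (u v : Fin 2 → ℝ) (hu : ∀ a, 0 < u a) (hv : ∀ a, 0 < v a)
    (hTu : T.mulVec u = l • u) (hTv : T.transpose.mulVec v = l • v) :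
    (0 < T 0 0 - T 1 1 ↔ 0 < u 0 * v 0 - u 1 * v 1) ∧
    (T 0 0 - T 1 1 = 0 ↔ u 0 * v 0 - u 1 * v 1 = 0) := by
  have hu0 : T 0 0 * u 0 + T 0 1 * u 1 = l * u 0 := by
    simpa [Matrix.mulVec, dotProduct, Fin.sum_univ_two] using congrFun hTu 0
  have hu1 : T 1 0 * u 0 + T 1 1 * u 1 = l * u 1 := by
    simpa [Matrix.mulVec, dotProduct, Fin.sum_univ_two] using congrFun hTu 1
  have hv0 : T 0 0 * v 0 + T 1 0 * v 1 = l * v 0 := by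
    simpa [Matrix.mulVec, dotProduct, Fin.sum_univ_two] using congrFun hTv 0
  have hgap : 0 < l - T 0 0 := by
    refine pos_of_mul_pos_left (b := u 0) ?_ (hu 0).le
    linarith [mul_pos (hT 0 1) (hu 1)]
  have hy : 0 < u 1 * v 1 := mul_pos (hu 1) (hv 1)
  have key : (T 0 0 - T 1 1) * (u 1 * v 1) = (l - T 0 0) * (u 0 * v 0 - u 1 * v 1) := by
    linear_combination u 0 * hv0 - v 1 * hu1
  constructor
  · rw [← mul_pos_iff_of_pos_right hy, key, mul_pos_iff_of_pos_left hgap]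
  · rw [← mul_eq_zero_iff_right hy.ne', key, mul_eq_zero_iff_left hgap.ne']
end

section
/- Marginal expansion formula (Theorem 6.1, degree-two vertex form): Let G = (V,E) be a finite simple graph, let vertex 1 ∈ V have degree 2 with neighbours i and j, and for every edge {u,v} ∈ E let ψ_{uv} : {−1,+1}² → (0,∞). Define Z = Σ_{σ : V → {−1,+1}} Π_{{u,v} ∈ E} ψ_{uv}(σ_u, σ_v), and for a ∈ {−1,+1} let Z·p₁(a) = Σ_{σ : σ₁ = a} Π_{{u,v} ∈ E} ψ_{uv}(σ_u, σ_v). Define the 2×2 matrix T'(a, a') = Σ_{σ : V∖{1} → {−1,+1}} ψ_{1i}(a, σ_i) ψ_{1j}(a', σ_j) Π_{{u,v} ∈ E, 1 ∉ {u,v}} ψ_{uv}(σ_u, σ_v). Let b : {−1,+1} → (0,1) satisfy b(+1) + b(−1) = 1, and set μ = (√(b(+1)), √(b(−1))), ν = (−√(b(−1)), √(b(+1))) ∈ ℝ². Then Z·p₁(±1) = b(±1)·( Σ_{a,a'} T'(a,a') μ(a) μ(a') ) + b(∓1)·( Σ_{a,a'} T'(a,a') ν(a) ν(a') ) ∓ √(b(+1)b(−1))·(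 Σ_{a,a'} T'(a,a') μ(a) ν(a') + Σ_{a,a'} T'(a,a') ν(a) μ(a') ). -/
/-- If every edge of `E` at `v` joins `v` to `i` or `j`, a product of symmetric edge weights
splits into the two weights at `v` and the product over the edges avoiding `v`. -/
theorem prod_edges_eq_mul_prod_filter {V M : Type*} [DecidableEq V] [CommMonoid M]
    {E : Finset (V × V)} (hasym : ∀ p ∈ E, (p.2, p.1) ∉ E)
    {v i j : V} (hij : i ≠ j) (hiv : i ≠ v) (hjv : j ≠ v)
    (hEi : (v, i) ∈ E ∨ (i, v) ∈ E) (hEj : (v, j) ∈ E ∨ (j, v) ∈ E)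
    (hdeg : ∀ p ∈ E, p.1 = v ∨ p.2 = v →
      p = (v, i) ∨ p = (i, v) ∨ p = (v, j) ∨ p = (j, v))
    {g : V → V → M} (hg : ∀ u w, g u w = g w u) :
    ∏ p ∈ E, g p.1 p.2 =
      g v i * g v j * ∏ p ∈ E.filter (fun p => p.1 ≠ v ∧ p.2 ≠ v), g p.1 p.2 := by
  obtain ⟨e, he, hei⟩ : ∃ e ∈ E, e = (v, i) ∨ e = (i, v) := by
    rcases hEi with h | h
    exacts [⟨_, h, .inl rfl⟩, ⟨_, h, .inr rfl⟩]
  obtain ⟨f, hf, hfj⟩ : ∃ f ∈ E, f = (v, j) ∨ f = (j, v) := by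
    rcases hEj with h | h
    exacts [⟨_, h, .inl rfl⟩, ⟨_, h, .inr rfl⟩]
  have hef : e ≠ f := by
    rcases hei with rfl | rfl <;> rcases hfj with rfl | rfl <;> grind
  have hfilter : E.filter (fun p => ¬(p.1 ≠ v ∧ p.2 ≠ v)) = {e, f} := by
    ext p
    simp only [Finset.mem_filter, Finset.mem_insert, Finset.mem_singleton]
    constructor
    · rintro ⟨hp, hpv⟩
      have hswap := hasym p hp
      rcases hdeg p hp (by tauto) with rfl | rfl | rfl | rfl <;>
        rcases hei with rfl | rfl <;> rcases hfj with rfl | rfl <;> simp_all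
    · rintro (rfl | rfl)
      · exact ⟨he, by rcases hei with rfl | rfl <;> simp⟩
      · exact ⟨hf, by rcases hfj with rfl | rfl <;> simp⟩
  have hge : g e.1 e.2 = g v i := by
    rcases hei with rfl | rfl
    exacts [rfl, hg _ _]
  have hgf : g f.1 f.2 = g v j := by
    rcases hfj with rfl | rfl
    exacts [rfl, hg _ _]
  rw [← Finset.prod_filter_not_mul_prod_filter E (fun p => p.1 ≠ v ∧ p.2 ≠ v), hfilter,
    Finset.prod_pair hef, hge, hgf]

/-- Summing over the configurations with a prescribed value at `v` a function that ignores the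
value at `v` gives a result independent of the prescribed value. -/
theorem sum_ite_apply_eq_of_update {V S M : Type*} [Fintype V] [DecidableEq V] [Fintype S]
    [DecidableEq S] [AddCommMonoid M] (v : V) (f : (V → S) → M)
    (hf : ∀ σ s, f (Function.update σ v s) = f σ) (x y : S) :
    ∑ σ, (if σ v = x then f σ else 0) = ∑ σ, if σ v = y then f σ else 0 := by
  have hinv : Function.Involutive
      fun σ : V → S => Function.update σ v (Equiv.swap x y (σ v)) := by
    intro σ
    simp
  rw [← Equiv.sum_comp hinv.toPerm]
  refine Finset.sum_congr rfl fun σ _ => ?_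
  have hswap : Equiv.swap x y (σ v) = x ↔ σ v = y := by
    rw [Equiv.swap_apply_eq_iff, Equiv.swap_apply_left]
  simp [hf, hswap]


/-- Marginal expansion formula (Theorem 6.1, degree-two vertex form): for a binary pairwise
Markov random field on a graph (edges given by the finset `E` of ordered pairs, each edge
appearing with exactly one orientation, compatibility functions `ψ` symmetric) in which the
vertex `v₁` has degree two with neighbours `i` and `j`, the true marginal `p₁` at `v₁`
satisfies
`Z·p₁(±1) = b(±1)·(Σ T' μμ) + b(∓1)·(Σ T' νν) ∓ √(b(+1)b(-1))·(Σ T' μν + Σ T' νμ)`,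
where `T'` is the transfer tensor obtained by cutting the graph at `v₁`, and `μ, ν` are the
first and secondary messages built from a belief `b` at `v₁`. -/
theorem marginal_expansion {V : Type*} [Fintype V] [DecidableEq V]
    (E : Finset (V × V))
    (hirr : ∀ p ∈ E, p.1 ≠ p.2)
    (hasym : ∀ p ∈ E, (p.2, p.1) ∉ E)
    (v₁ i j : V) (hij : i ≠ j) (hiv : i ≠ v₁) (hjv : j ≠ v₁)
    (hEi : (v₁, i) ∈ E ∨ (i, v₁) ∈ E)
    (hEj : (v₁, j) ∈ E ∨ (j, v₁) ∈ E)
    (hdeg : ∀ p ∈ E, p.1 = v₁ ∨ p.2 = v₁ →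
      p = (v₁, i) ∨ p = (i, v₁) ∨ p = (v₁, j) ∨ p = (j, v₁))
    (ψ : V → V → ℝ → ℝ → ℝ)
    (hψsym : ∀ u v : V, ∀ x y : ℝ, ψ u v x y = ψ v u y x)
    (hψpos : ∀ p ∈ E, ∀ x ∈ ({-1, 1} : Finset ℝ), ∀ y ∈ ({-1, 1} : Finset ℝ),
      0 < ψ p.1 p.2 x y)
    (Z : ℝ)
    (hZ : Z = ∑ σ : V → ({-1, 1} : Finset ℝ), ∏ p ∈ E, ψ p.1 p.2 (σ p.1 : ℝ) (σ p.2 : ℝ))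
    (p₁ : ℝ → ℝ)
    (hp₁ : ∀ a ∈ ({-1, 1} : Finset ℝ), Z * p₁ a =
      ∑ σ : V → ({-1, 1} : Finset ℝ),
        if (σ v₁ : ℝ) = a then ∏ p ∈ E, ψ p.1 p.2 (σ p.1 : ℝ) (σ p.2 : ℝ) else 0)
    (T' : ℝ → ℝ → ℝ)
    (hT' : ∀ a a' : ℝ, T' a a' =
      ∑ σ : V → ({-1, 1} : Finset ℝ),
        if (σ v₁ : ℝ) = 1 then
          ψ v₁ i a (σ i : ℝ) * ψ v₁ j a' (σ j : ℝ) *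
            ∏ p ∈ E.filter (fun p => p.1 ≠ v₁ ∧ p.2 ≠ v₁),
              ψ p.1 p.2 (σ p.1 : ℝ) (σ p.2 : ℝ)
        else 0)
    (b : ℝ → ℝ) (hbp : 0 < b 1) (hbm : 0 < b (-1)) (hbsum : b 1 + b (-1) = 1)
    (μ ν : ℝ → ℝ)
    (hμ1 : μ 1 = Real.sqrt (b 1)) (hμm : μ (-1) = Real.sqrt (b (-1)))
    (hν1 : ν 1 = -Real.sqrt (b (-1))) (hνm : ν (-1) = Real.sqrt (b 1)) :
    (Z * p₁ 1 =
      b 1 * (∑ a ∈ ({-1, 1} : Finset ℝ), ∑ a' ∈ ({-1, 1} : Finset ℝ), T' a a' * μ a * μ a') +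
      b (-1) * (∑ a ∈ ({-1, 1} : Finset ℝ), ∑ a' ∈ ({-1, 1} : Finset ℝ), T' a a' * ν a * ν a') -
      Real.sqrt (b 1 * b (-1)) *
        ((∑ a ∈ ({-1, 1} : Finset ℝ), ∑ a' ∈ ({-1, 1} : Finset ℝ), T' a a' * μ a * ν a') +
          ∑ a ∈ ({-1, 1} : Finset ℝ), ∑ a' ∈ ({-1, 1} : Finset ℝ), T' a a' * ν a * μ a')) ∧
    (Z * p₁ (-1) =
      b (-1) * (∑ a ∈ ({-1, 1} : Finset ℝ), ∑ a' ∈ ({-1, 1} : Finset ℝ), T' a a' * μ a * μ a') +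
      b 1 * (∑ a ∈ ({-1, 1} : Finset ℝ), ∑ a' ∈ ({-1, 1} : Finset ℝ), T' a a' * ν a * ν a') +
      Real.sqrt (b 1 * b (-1)) *
        ((∑ a ∈ ({-1, 1} : Finset ℝ), ∑ a' ∈ ({-1, 1} : Finset ℝ), T' a a' * μ a * ν a') +
          ∑ a ∈ ({-1, 1} : Finset ℝ), ∑ a' ∈ ({-1, 1} : Finset ℝ), T' a a' * ν a * μ a')) := by
  have hdiag : ∀ a ∈ ({-1, 1} : Finset ℝ), Z * p₁ a = T' a a := by
    intro a ha
    let F : (V → ({-1, 1} : Finset ℝ)) → ℝ := fun σ =>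
      ψ v₁ i a (σ i : ℝ) * ψ v₁ j a (σ j : ℝ) *
        ∏ p ∈ E.filter (fun p => p.1 ≠ v₁ ∧ p.2 ≠ v₁), ψ p.1 p.2 (σ p.1 : ℝ) (σ p.2 : ℝ)
    have hF : ∀ σ s, F (Function.update σ v₁ s) = F σ := by
      intro σ s
      simp only [F, Function.update_of_ne hiv, Function.update_of_ne hjv]
      congr 1
      refine Finset.prod_congr rfl fun p hp => ?_
      obtain ⟨-, h₁, h₂⟩ := Finset.mem_filter.mp hp
      rw [Function.update_of_ne h₁, Function.update_of_ne h₂]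
    have hsum := sum_ite_apply_eq_of_update v₁ F hF ⟨a, ha⟩ ⟨1, by simp⟩
    simp only [Subtype.ext_iff] at hsum
    rw [hp₁ a ha, hT' a a, ← hsum]
    refine Finset.sum_congr rfl fun σ _ => ?_
    split_ifs with h
    · rw [prod_edges_eq_mul_prod_filter hasym hij hiv hjv hEi hEj hdeg
        (g := fun u w => ψ u w (σ u : ℝ) (σ w : ℝ)) fun u w => hψsym u w _ _, h]
    · rfl
  have hne : (-1 : ℝ) ≠ 1 := by norm_num
  rw [hdiag 1 (by simp), hdiag (-1) (by simp), Real.sqrt_mul hbp.le]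
  simp only [Finset.sum_pair hne, hμ1, hμm, hν1, hνm]
  have hs := Real.sq_sqrt hbp.le
  have ht := Real.sq_sqrt hbm.le
  set s := Real.sqrt (b 1)
  set t := Real.sqrt (b (-1))
  rw [← hs, ← ht] at hbsum
  rw [← hs, ← ht]
  have hsq : (s ^ 2 + t ^ 2) ^ 2 = 1 := by rw [hbsum, one_pow]
  constructor
  · linear_combination -T' 1 1 * hsq
  · linear_combination -T' (-1) (-1) * hsq
end
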